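/- arXiv:2001.01322 — 4 statements merged into one kernel-verified Lean document; each statement's English description precedes it below -/
import Mathlib

section
/- Let γ : ∂𝔹 → Γ be an orientation-preserving homeomorphism of the unit circle onto a simple closed curve Γ = ∂Ω, C¹ at all points except a finite set S ⊂ ∂𝔹, with γ' nonvanishing on ∂𝔹 \ S and, at each point of S, one-sided derivatives γ'₊, γ'₋ existing, nonvanishing, and equal to the one-sided limits of γ'. Let φ ∈ C²(𝔹, ℝ²) ∩ C¹(cl(𝔹) \ S, ℝ²) be the harmonic extension of γ, and assume that on all of ∂𝔹 the inward normal derivative ∂φ/∂ν exists, is continuous, and does not vanish, and that φ satisfies the cone condition ∂φ/∂ν(e^{iθ}) ∈ 𝒞_θ at every point of ∂𝔹. Then φ is a local homeomorphism around every boundary point e^{iθ}, −π ≤ θ ≤ π; that is, each e^{iθ} ∈ ∂𝔹 has a neighborhood in cl(𝔹) on which φ is injective. -/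
noncomputable section

open Set Metric Filter

/-- Euclidean dot product of two complex numbers viewed as vectors in ℝ². -/
def dotC (u v : ℂ) : ℝ := u.re * v.re + u.im * v.im

/-- Clockwise rotation by π/2 of a planar vector (identified with ℂ):
`(x, y)^⊥ = (y, -x)`. -/
def perpC (z : ℂ) : ℂ := -Complex.I * z

/-- Cross product (2×2 determinant) of two planar vectors. -/
def crossC (u v : ℂ) : ℝ := u.re * v.im - u.im * v.re

/-- The Laplacian of a function `f : ℂ → ℝ` (ℂ is identified with ℝ²),
as the sum of the second derivatives in the two coordinate directions. -/
def lap2 (f : ℂ → ℝ) (z : ℂ) : ℝ :=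
  fderiv ℝ (fun w => fderiv ℝ f w 1) z 1 +
  fderiv ℝ (fun w => fderiv ℝ f w Complex.I) z Complex.I

/-- `φ : ℂ → ℂ` is harmonic (componentwise, Δφ = 0) on the set `s`. -/
def HarmonicOn2 (φ : ℂ → ℂ) (s : Set ℂ) : Prop :=
  ∀ z ∈ s, lap2 (fun w => (φ w).re) z = 0 ∧ lap2 (fun w => (φ w).im) z = 0

/-- The point `e^{iθ}` of the unit circle ∂𝔹. -/
def cpt (θ : ℝ) : ℂ := Complex.exp (θ * Complex.I)

/-- `u` coincides on the open unit disk with the real part of a holomorphic function. -/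
def IsReHolo (u : ℂ → ℝ) : Prop :=
  ∃ F : ℂ → ℂ, DifferentiableOn ℂ F (ball 0 1) ∧ ∀ z ∈ ball (0 : ℂ) 1, u z = (F z).re

lemma isReHolo_of_lap2_eq_zero {f : ℂ → ℝ} (hf : ContDiffOn ℝ 2 f (ball 0 1))
    (h : ∀ z ∈ ball (0 : ℂ) 1, lap2 f z = 0) : IsReHolo f := by
  have key : InnerProductSpace.HarmonicOnNhd f (ball 0 1) := by
    intro z hz
    refine ⟨hf.contDiffAt (isOpen_ball.mem_nhds hz), ?_⟩
    filter_upwards [isOpen_ball.mem_nhds hz] with w hw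
    have hd : DifferentiableAt ℝ (fderiv ℝ f) w :=
      ((hf.contDiffAt (isOpen_ball.mem_nhds hw)).fderiv_right (m := 1) (by norm_num)).differentiableAt
        (by norm_num)
    have e := h w hw
    have a : ∀ v : ℂ, fderiv ℝ (fun w => fderiv ℝ f w v) w v = fderiv ℝ (fderiv ℝ f) w v v := by
      intro v
      rw [fderiv_clm_apply hd (by fun_prop)]
      simp
    rw [lap2, a, a] at e
    rw [InnerProductSpace.laplacian_eq_iteratedFDeriv_complexPlane]
    simpa [iteratedFDeriv_two_apply] using e
  obtain ⟨F, hF, h2⟩ := key.exists_analyticOnNhd_ball_re_eq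
  exact ⟨F, hF.differentiableOn, fun z hz => (h2 hz).symm⟩

lemma IsReHolo.sub {u v : ℂ → ℝ} (hu : IsReHolo u) (hv : IsReHolo v) :
    IsReHolo (fun z => u z - v z) := by
  obtain ⟨F, hF, h1⟩ := hu
  obtain ⟨G, hG, h2⟩ := hv
  exact ⟨fun z => F z - G z, hF.sub hG, fun z hz => by simp [h1 z hz, h2 z hz]⟩

lemma IsReHolo.add_linear {u : ℂ → ℝ} (hu : IsReHolo u) (c : ℂ) :
    IsReHolo (fun z => u z + (z * c).re) := by
  obtain ⟨F, hF, h1⟩ := hu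
  exact ⟨fun z => F z + z * c, hF.add (by fun_prop), fun z hz => by simp [h1 z hz]⟩

lemma IsReHolo.comp_mul {u : ℂ → ℝ} (hu : IsReHolo u) {a : ℂ} (ha : ‖a‖ ≤ 1) :
    IsReHolo (fun z => u (a * z)) := by
  obtain ⟨F, hF, h1⟩ := hu
  have hm : ∀ z ∈ ball (0 : ℂ) 1, a * z ∈ ball (0 : ℂ) 1 := by
    intro z hz
    rw [mem_ball_zero_iff] at hz ⊢
    rw [norm_mul]
    nlinarith [norm_nonneg z, norm_nonneg a]
  exact ⟨fun z => F (a * z), hF.comp (by fun_prop) hm, fun z hz => h1 _ (hm z hz)⟩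

lemma IsReHolo.differentiableAt {u : ℂ → ℝ} (hu : IsReHolo u) {z : ℂ} (hz : z ∈ ball (0 : ℂ) 1) :
    DifferentiableAt ℝ u z := by
  obtain ⟨F, hF, h1⟩ := hu
  have h2 : DifferentiableAt ℝ F z :=
    (hF.differentiableAt (isOpen_ball.mem_nhds hz)).restrictScalars ℝ
  have h3 : DifferentiableAt ℝ (fun w => (F w).re) z :=
    Complex.reCLM.differentiableAt.comp z h2
  refine h3.congr_of_eventuallyEq ?_
  filter_upwards [isOpen_ball.mem_nhds hz] with w hw using h1 w hw

/-- Weak maximum principle on the unit disk. -/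
lemma IsReHolo.exists_sphere_isMaxOn {u : ℂ → ℝ} (hu : IsReHolo u)
    (hc : ContinuousOn u (closedBall 0 1)) :
    ∃ ζ ∈ sphere (0 : ℂ) 1, ∀ z ∈ closedBall (0 : ℂ) 1, u z ≤ u ζ := by
  obtain ⟨w, hw, hmax⟩ := (isCompact_closedBall (0 : ℂ) 1).exists_isMaxOn ⟨0, by simp⟩ hc
  by_cases hws : w ∈ sphere (0 : ℂ) 1
  · exact ⟨w, hws, fun z hz => hmax hz⟩
  have hwb : w ∈ ball (0 : ℂ) 1 := by
    rw [← closedBall_sdiff_sphere]; exact ⟨hw, hws⟩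
  obtain ⟨F, hF, h1⟩ := hu
  have hconst := Complex.norm_eqOn_of_isPreconnected_of_isMaxOn (f := fun z => Complex.exp (F z))
    (convex_ball (0 : ℂ) 1).isPreconnected isOpen_ball hF.cexp hwb (by
      intro z hz
      have := hmax (ball_subset_closedBall hz)
      simp only [mem_ofPred_eq, Function.comp, Complex.norm_exp, Real.exp_le_exp] at this ⊢
      rwa [← h1 z hz, ← h1 w hwb])
  have hb : EqOn u (fun _ => u w) (ball 0 1) := by
    intro z hz
    have := hconst hz
    simp only [Function.comp, Function.const, Complex.norm_exp, Real.exp_eq_exp] at this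
    rw [h1 z hz, this, ← h1 w hwb]
  have hcl : EqOn u (fun _ => u w) (closedBall 0 1) :=
    hb.of_subset_closure hc continuousOn_const ball_subset_closedBall
      (by rw [closure_ball _ one_ne_zero])
  refine ⟨1, by simp, fun z hz => ?_⟩
  rw [hcl (x := 1) (by simp)]
  exact hmax hz

lemma nonpos_of_hasDerivWithinAt_Ici {g : ℝ → ℝ} {d x : ℝ} (h : HasDerivWithinAt g d (Ici x) x)
    (hmax : ∀ᶠ y in nhdsWithin x (Ici x), g y ≤ g x) : d ≤ 0 := by
  rw [hasDerivWithinAt_iff_tendsto_slope] at h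
  have hs : Ici x \ {x} = Ioi x := by ext y; simp [lt_iff_le_and_ne]
  rw [hs] at h
  refine le_of_tendsto h ?_
  filter_upwards [hmax.filter_mono (nhdsWithin_mono x Ioi_subset_Ici_self), self_mem_nhdsWithin]
    with y hy hxy
  rw [slope_def_field]
  exact div_nonpos_of_nonpos_of_nonneg (by linarith) (by simpa using (le_of_lt hxy))

lemma hasDerivWithinAt_Ici_zero_comp_add {g : ℝ → ℝ} {d x : ℝ} :
    HasDerivWithinAt (fun s => g (x + s)) d (Ici 0) 0 ↔ HasDerivWithinAt g d (Ici x) x := by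
  constructor
  · intro h
    have h' : HasDerivWithinAt (fun s => g (x + s)) d (Ici 0) (x - x) := by simpa using h
    have := h'.comp (h₂ := fun s => g (x + s)) (h := fun s : ℝ => s - x) (s := Ici x) x
      ((hasDerivWithinAt_id x (Ici x)).sub_const x) (fun y hy => by simpa using hy)
    simpa [Function.comp_def] using this
  · intro h
    have h' : HasDerivWithinAt g d (Ici x) (x + 0) := by simpa using h
    have := h'.comp (h₂ := g) (h := fun s : ℝ => x + s) (s := Ici 0) 0
      ((hasDerivWithinAt_id 0 (Ici 0)).const_add x) (fun y hy => by simpa using hy)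
    simpa [Function.comp_def] using this

lemma norm_cpt (θ : ℝ) : ‖cpt θ‖ = 1 := Complex.norm_exp_ofReal_mul_I θ

lemma cpt_add (a b : ℝ) : cpt (a + b) = cpt a * cpt b := by
  simp [cpt, ← Complex.exp_add, add_mul]

lemma continuous_cpt : Continuous cpt := by
  unfold cpt; fun_prop

lemma re_cpt (θ : ℝ) : (cpt θ).re = Real.cos θ := Complex.exp_ofReal_mul_I_re θ

lemma im_cpt (θ : ℝ) : (cpt θ).im = Real.sin θ := Complex.exp_ofReal_mul_I_im θ

/-- If the angular derivative is at most `a` on the unit circle, then angular increments inside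
the disk are bounded accordingly. -/
lemma IsReHolo.angular_increment_le {f : ℂ → ℝ} (hf : IsReHolo f)
    (hc : ContinuousOn f (closedBall 0 1)) {a : ℝ}
    (hd : ∀ z ∈ sphere (0 : ℂ) 1,
      ∃ d ≤ a, HasDerivWithinAt (fun h : ℝ => f (cpt h * z)) d (Ici 0) 0)
    {z : ℂ} (hz : z ∈ closedBall (0 : ℂ) 1) {h : ℝ} (hh : 0 ≤ h) :
    f (cpt h * z) - f z ≤ a * h := by
  have hm : MapsTo (fun z => cpt h * z) (closedBall (0 : ℂ) 1) (closedBall 0 1) := by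
    intro w hw
    simpa [norm_cpt] using hw
  have hu := (hf.comp_mul (norm_cpt h).le).sub hf
  obtain ⟨ζ, hζ, hmax⟩ := hu.exists_sphere_isMaxOn ((hc.comp (by fun_prop) hm).sub hc)
  refine (hmax z hz).trans ?_
  have hζ1 : ‖ζ‖ = 1 := by simpa using hζ
  have hsph : ∀ t : ℝ, cpt t * ζ ∈ sphere (0 : ℂ) 1 := fun t => by simp [norm_cpt, hζ1]
  have hd' : ∀ t : ℝ, ∃ d ≤ a, HasDerivWithinAt (fun h : ℝ => f (cpt h * ζ)) d (Ici t) t := by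
    intro t
    obtain ⟨d, hda, hder⟩ := hd _ (hsph t)
    refine ⟨d, hda, hasDerivWithinAt_Ici_zero_comp_add.1 ?_⟩
    convert hder using 3 with s
    rw [cpt_add]; ring
  choose d hda hder using hd'
  have hcont : Continuous fun t : ℝ => f (cpt t * ζ) :=
    hc.comp_continuous (continuous_cpt.mul continuous_const)
      fun t => sphere_subset_closedBall (hsph t)
  have := image_le_of_deriv_right_le_deriv_boundary (f := fun t : ℝ => f (cpt t * ζ)) (f' := d)
    (a := 0) (b := h) (B := fun t => f ζ + a * t) (B' := fun _ => a) hcont.continuousOn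
    (fun x _ => hder x) (by simp [cpt]) (by fun_prop)
    (fun x _ => by simpa using (((hasDerivAt_id x).const_mul a).const_add (f ζ)).hasDerivWithinAt)
    (fun x _ => hda x) (right_mem_Icc.2 hh)
  linarith

/-- If the outward radial derivative is at most `a` on the unit circle, then radial increments
inside the disk are bounded accordingly, in the logarithmic variable. -/
lemma IsReHolo.radial_increment_le {f : ℂ → ℝ} (hf : IsReHolo f)
    (hc : ContinuousOn f (closedBall 0 1)) {a : ℝ}
    (hd : ∀ z ∈ sphere (0 : ℂ) 1,
      ∃ d ≥ -a, HasDerivWithinAt (fun ν : ℝ => f (((1 - ν : ℝ) : ℂ) * z)) d (Ici 0) 0)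
    {z : ℂ} (hz : z ∈ closedBall (0 : ℂ) 1) {σ : ℝ} (hσ : 0 ≤ σ) :
    f z - f ((Real.exp (-σ) : ℝ) * z) ≤ a * σ := by
  have hball : ∀ s : ℝ, 0 ≤ s → ∀ w ∈ closedBall (0 : ℂ) 1,
      ((Real.exp (-s) : ℝ) : ℂ) * w ∈ closedBall (0 : ℂ) 1 := by
    intro s hs w hw
    rw [mem_closedBall_zero_iff] at hw ⊢
    rw [norm_mul, Complex.norm_real, Real.norm_of_nonneg (Real.exp_pos _).le]
    exact mul_le_one₀ (Real.exp_le_one_iff.2 (by linarith)) (norm_nonneg _) hw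
  refine le_of_forall_pos_le_add fun ε hε => ?_
  obtain ⟨η, hη, hηε⟩ : ∃ η > 0, η * σ ≤ ε := by
    refine ⟨ε / (σ + 1), by positivity, ?_⟩
    rw [div_mul_eq_mul_div, div_le_iff₀ (by positivity)]
    nlinarith
  suffices H : f z - f ((Real.exp (-σ) : ℝ) * z) - (a + η) * σ ≤ 0 by linarith
  set Q : ℝ × ℂ → ℝ := fun p => f p.2 - f ((Real.exp (-p.1) : ℝ) * p.2) - (a + η) * p.1 with hQ
  have hQc : ContinuousOn Q (Icc 0 σ ×ˢ closedBall (0 : ℂ) 1) := by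
    refine ((hc.comp continuousOn_snd fun p hp => hp.2).sub (hc.comp ?_ fun p hp => ?_)).sub
      (by fun_prop)
    · fun_prop
    · exact hball _ hp.1.1 _ hp.2
  obtain ⟨⟨s, w⟩, ⟨hs, hw⟩, hmax⟩ := (isCompact_Icc.prod (isCompact_closedBall (0 : ℂ) 1)).exists_isMaxOn
    ⟨(0, 0), ⟨⟨le_rfl, hσ⟩, by simp⟩⟩ hQc
  simp only at hs hw
  have hu : IsReHolo fun z => f z - f ((Real.exp (-s) : ℝ) * z) :=
    hf.sub (hf.comp_mul (by
      rw [Complex.norm_real, Real.norm_of_nonneg (Real.exp_pos _).le]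
      exact Real.exp_le_one_iff.2 (by linarith [hs.1])))
  obtain ⟨ζ, hζ, hζmax⟩ := hu.exists_sphere_isMaxOn
    (hc.sub (hc.comp (by fun_prop) fun w hw => hball s hs.1 w hw))
  have hζ1 : ‖ζ‖ = 1 := by simpa using hζ
  have hζc : ζ ∈ closedBall (0 : ℂ) 1 := sphere_subset_closedBall hζ
  have hmax' : ∀ t ∈ Icc 0 σ, ∀ y ∈ closedBall (0 : ℂ) 1, Q (t, y) ≤ Q (s, ζ) := by
    intro t ht y hy
    refine (hmax (show (t, y) ∈ _ from ⟨ht, hy⟩)).trans ?_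
    have := hζmax w hw
    simp only [hQ]
    linarith
  refine (hmax' σ ⟨hσ, le_rfl⟩ z hz).trans ?_
  rcases hs.1.eq_or_lt with h0 | h0
  · simp [hQ, ← h0]
  exfalso
  obtain ⟨d, hda, hder⟩ := hd ζ hζ
  have hr : HasDerivWithinAt (fun p : ℝ => f ((Real.exp (-p) : ℝ) * ζ)) d (Ici 0) 0 := by
    have h1 : HasDerivWithinAt (fun p : ℝ => 1 - Real.exp (-p)) 1 (Ici 0) 0 := by
      have := (((hasDerivAt_id (0 : ℝ)).neg.exp).const_sub 1).hasDerivWithinAt (s := Ici 0)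
      simpa using this
    have h2 : HasDerivWithinAt (fun ν : ℝ => f (((1 - ν : ℝ) : ℂ) * ζ)) d (Ici 0)
        (1 - Real.exp (-0)) := by simpa using hder
    have := h2.comp (h := fun p : ℝ => 1 - Real.exp (-p)) (0 : ℝ) h1
      (fun p hp => by simpa using hp)
    simpa [Function.comp_def] using this
  have hin : ((Real.exp (-s) : ℝ) : ℂ) * ζ ∈ ball (0 : ℂ) 1 := by
    rw [mem_ball_zero_iff, norm_mul, hζ1, mul_one, Complex.norm_real,
      Real.norm_of_nonneg (Real.exp_pos _).le]
    rw [← Real.exp_zero]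
    exact Real.exp_lt_exp.2 (by linarith)
  have hdiff : DifferentiableAt ℝ (fun p : ℝ => f ((Real.exp (-p) : ℝ) * ζ)) s := by
    refine DifferentiableAt.comp s (g := f) (hf.differentiableAt hin) ?_
    have : DifferentiableAt ℝ (fun p : ℝ => ((Real.exp (-p) : ℝ) : ℂ)) s :=
      Complex.ofRealCLM.differentiableAt.comp s (f := fun p : ℝ => Real.exp (-p)) (by fun_prop)
    exact this.mul_const ζ
  obtain ⟨D, hD⟩ : ∃ D, HasDerivAt (fun p : ℝ => f ((Real.exp (-p) : ℝ) * ζ)) D s :=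
    ⟨_, hdiff.hasDerivAt⟩
  have hle1 : D + (a + η) ≤ 0 := by
    have hD' : HasDerivAt (fun p : ℝ => f ((Real.exp (-p) : ℝ) * ζ)) D (s - 0) := by simpa using hD
    have h1 : HasDerivAt (fun t : ℝ => Q (s - t, ζ)) (D + (a + η)) 0 := by
      have hst : HasDerivAt (fun t : ℝ => s - t) (-1) 0 := by
        simpa using (hasDerivAt_id (0 : ℝ)).const_sub s
      have h3 := ((hD'.comp (0 : ℝ) hst).const_sub (f ζ)).sub (hst.const_mul (a + η))
      exact h3.congr_deriv (by ring)
    refine nonpos_of_hasDerivWithinAt_Ici (h1.hasDerivWithinAt (s := Ici 0)) ?_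
    filter_upwards [self_mem_nhdsWithin, nhdsWithin_le_nhds (Iic_mem_nhds h0)] with t ht hts
    simp only [mem_Ici, mem_Iic] at ht hts
    simpa using hmax' (s - t) ⟨by linarith, by linarith [hs.2]⟩ ζ hζc
  have hle2 : d - D ≤ 0 := by
    have hs2 : HasDerivWithinAt (fun p : ℝ => f ((Real.exp (-(s + p)) : ℝ) * ζ)) D (Ici 0) 0 :=
      hasDerivWithinAt_Ici_zero_comp_add (g := fun p : ℝ => f ((Real.exp (-p) : ℝ) * ζ)).2
        hD.hasDerivWithinAt
    refine nonpos_of_hasDerivWithinAt_Ici (hr.sub hs2) ?_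
    filter_upwards [self_mem_nhdsWithin] with p hp
    have := hmax' s hs _ (hball p hp ζ hζc)
    simp only [hQ, ← mul_assoc, ← Complex.ofReal_mul, ← Real.exp_add] at this
    simp only [neg_add, neg_zero, add_zero, Real.exp_zero, Complex.ofReal_one, one_mul, Pi.sub_apply]
    linarith
  linarith

lemma exists_cosine_barrier {g : ℝ → ℝ} {θ₀ c : ℝ} (hb : ∀ θ, ∃ M, ∀ᶠ x in nhds θ, g x ≤ M)
    (h0 : ∀ᶠ x in nhds θ₀, g x ≤ -c) :
    ∃ K ≥ 0, ∀ θ ∈ Icc (θ₀ - Real.pi) (θ₀ + Real.pi), g θ ≤ -c + K * (1 - Real.cos (θ - θ₀)) := by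
  refine isCompact_Icc.induction_on
    (p := fun s => ∃ K ≥ 0, ∀ θ ∈ s, g θ ≤ -c + K * (1 - Real.cos (θ - θ₀)))
    ⟨0, le_rfl, by simp⟩ ?_ ?_ ?_
  · rintro s t hst ⟨K, hK, h⟩
    exact ⟨K, hK, fun θ hθ => h θ (hst hθ)⟩
  · rintro s t ⟨K, hK, h⟩ ⟨L, hL, h'⟩
    refine ⟨K + L, by positivity, fun θ hθ => ?_⟩
    have hcos : 0 ≤ 1 - Real.cos (θ - θ₀) := by linarith [Real.cos_le_one (θ - θ₀)]
    rcases hθ with hθ | hθ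
    · nlinarith [h θ hθ, mul_nonneg hL hcos]
    · nlinarith [h' θ hθ, mul_nonneg hK hcos]
  · intro θ hθ
    by_cases hθ0 : θ = θ₀
    · subst hθ0
      exact ⟨_, nhdsWithin_le_nhds h0, 0, le_rfl, fun x hx => by simpa using hx⟩
    · obtain ⟨M, hM⟩ := hb θ
      have hlt : Real.cos (θ - θ₀) < 1 := by
        refine lt_of_le_of_ne (Real.cos_le_one _) fun h => hθ0 ?_
        have := (Real.cos_eq_one_iff_of_lt_of_lt (by linarith [hθ.1, Real.pi_pos])
          (by linarith [hθ.2, Real.pi_pos])).1 h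
        linarith
      set m := (1 - Real.cos (θ - θ₀)) / 2 with hm
      have hmpos : 0 < m := by linarith
      have hev : ∀ᶠ x in nhds θ, m < 1 - Real.cos (x - θ₀) :=
        ContinuousAt.eventually_lt (f := fun _ => m) (g := fun x => 1 - Real.cos (x - θ₀))
          (by fun_prop) (by fun_prop) (by linarith)
      refine ⟨_, nhdsWithin_le_nhds (hM.and hev), |M + c| / m, by positivity, ?_⟩
      rintro x ⟨hx1, hx2⟩
      have h1 : |M + c| ≤ |M + c| / m * (1 - Real.cos (x - θ₀)) := by
        calc |M + c| = |M + c| / m * m := by field_simp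
          _ ≤ _ := by gcongr
      linarith [le_abs_self (M + c)]

lemma exists_cpt_eq (θ₀ : ℝ) {z : ℂ} (hz : z ∈ sphere (0 : ℂ) 1) :
    ∃ θ ∈ Icc (θ₀ - Real.pi) (θ₀ + Real.pi), cpt θ = z := by
  have hz1 : ‖z * cpt (-θ₀)‖ = 1 := by
    rw [norm_mul, norm_cpt, mul_one]; simpa using hz
  have h1 : cpt (z * cpt (-θ₀)).arg = z * cpt (-θ₀) := by
    have := Complex.norm_mul_exp_arg_mul_I (z * cpt (-θ₀))
    rwa [hz1, Complex.ofReal_one, one_mul] at this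
  refine ⟨θ₀ + (z * cpt (-θ₀)).arg, ⟨?_, ?_⟩, ?_⟩
  · linarith [Complex.neg_pi_lt_arg (z * cpt (-θ₀))]
  · linarith [Complex.arg_le_pi (z * cpt (-θ₀))]
  · rw [cpt_add, h1, mul_left_comm, ← cpt_add]; simp [cpt]

lemma exists_one_sub_mul_cos_lt (K : ℝ) {c : ℝ} (hc : 0 < c) :
    ∃ δ > 0, δ < 1 ∧ ∀ r x : ℝ, 1 - δ < r → r ≤ 1 → |x| < δ →
      0 < Real.cos x ∧ K * (1 - r * Real.cos x) < c := by
  have h1 : ∀ᶠ p : ℝ × ℝ in nhds (1, 0), 0 < Real.cos p.2 :=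
    ContinuousAt.eventually_lt (f := fun _ => 0) (g := fun p : ℝ × ℝ => Real.cos p.2)
      (by fun_prop) (by fun_prop) (by simp)
  have h2 : ∀ᶠ p : ℝ × ℝ in nhds (1, 0), K * (1 - p.1 * Real.cos p.2) < c :=
    ContinuousAt.eventually_lt (f := fun p : ℝ × ℝ => K * (1 - p.1 * Real.cos p.2))
      (g := fun _ => c) (by fun_prop) (by fun_prop) (by simpa using hc)
  obtain ⟨δ, hδ, h⟩ := Metric.eventually_nhds_iff.1 (h1.and h2)
  refine ⟨min δ (1 / 2), by positivity, (min_le_right _ _).trans_lt (by norm_num), ?_⟩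
  intro r x hr hr1 hx
  refine h (y := (r, x)) ?_
  rw [Prod.dist_eq, max_lt_iff, Real.dist_eq, Real.dist_eq, sub_zero]
  refine ⟨?_, hx.trans_le (min_le_left _ _)⟩
  rw [abs_lt]
  constructor <;> linarith [min_le_left δ (1 / 2)]

lemma re_mul_cpt_mul (r K θ θ₀ : ℝ) :
    ((r : ℂ) * cpt θ * (K * cpt (-θ₀))).re = r * K * Real.cos (θ - θ₀) := by
  have : (r : ℂ) * cpt θ * (K * cpt (-θ₀)) = ((r * K : ℝ) : ℂ) * cpt (θ - θ₀) := by
    rw [sub_eq_add_neg, cpt_add]; push_cast; ring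
  rw [this, Complex.re_ofReal_mul, re_cpt]

lemma re_mul_cpt_mul_neg_I (r K θ θ₀ : ℝ) :
    ((r : ℂ) * cpt θ * (K * cpt (-θ₀) * -Complex.I)).re = r * K * Real.sin (θ - θ₀) := by
  have : (r : ℂ) * cpt θ * (K * cpt (-θ₀) * -Complex.I)
      = ((r * K : ℝ) : ℂ) * (cpt (θ - θ₀) * -Complex.I) := by
    rw [sub_eq_add_neg, cpt_add]; push_cast; ring
  rw [this, Complex.re_ofReal_mul]
  simp [im_cpt]

/-- A positive inward derivative at a boundary point makes `f` strictly decreasing in the radius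
near that point. -/
lemma IsReHolo.exists_radial_lt {f : ℂ → ℝ} (hf : IsReHolo f)
    (hc : ContinuousOn f (closedBall 0 1)) {d : ℝ → ℝ}
    (hd : ∀ θ : ℝ, HasDerivWithinAt (fun ν : ℝ => f (((1 - ν : ℝ) : ℂ) * cpt θ)) (d θ) (Ici 0) 0)
    (hdc : Continuous d) {θ₀ : ℝ} (h0 : 0 < d θ₀) :
    ∃ δ > 0, ∀ θ r₁ r₂ : ℝ, |θ - θ₀| < δ → 1 - δ < r₁ → r₁ < r₂ → r₂ ≤ 1 →
      f (r₂ * cpt θ) < f (r₁ * cpt θ) := by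
  obtain ⟨c, hcpos, hcd⟩ := exists_between h0
  obtain ⟨K, hK0, hK⟩ := exists_cosine_barrier (g := fun θ => -d θ) (θ₀ := θ₀) (c := c)
    (fun θ => ⟨-d θ + 1, (hdc.neg.continuousAt.eventually_lt_const
      (lt_add_one (-d θ))).mono fun x hx => hx.le⟩)
    ((hdc.continuousAt.eventually_const_lt hcd).mono fun x hx => by linarith)
  obtain ⟨δ, hδ, hδ1, hsmall⟩ := exists_one_sub_mul_cos_lt K hcpos
  refine ⟨δ, hδ, fun θ r₁ r₂ hθ hr₁ hr hr₂ => ?_⟩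
  have hr₁0 : 0 < r₁ := by linarith
  have hr₂0 : 0 < r₂ := by linarith
  have hmain := (hf.add_linear (K * cpt (-θ₀))).radial_increment_le (a := K - c)
    (hc.add (by fun_prop)) (fun z hz => by
      obtain ⟨t, ht, rfl⟩ := exists_cpt_eq θ₀ hz
      have hlin : HasDerivWithinAt
          (fun ν : ℝ => (((1 - ν : ℝ) : ℂ) * cpt t * (K * cpt (-θ₀))).re)
          (-(K * Real.cos (t - θ₀))) (Ici 0) 0 := by
        simp only [re_mul_cpt_mul]
        have := (((hasDerivAt_id (0 : ℝ)).const_sub 1).mul_const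
          (K * Real.cos (t - θ₀))).hasDerivWithinAt (s := Ici 0)
        simpa [mul_assoc] using this
      refine ⟨_, ?_, (hd t).add hlin⟩
      linarith [hK t ht]) (z := r₂ * cpt θ) (by simp [norm_cpt, abs_of_pos hr₂0, hr₂])
    (σ := Real.log (r₂ / r₁)) (Real.log_nonneg ((one_le_div hr₁0).2 hr.le))
  have hexp : ((Real.exp (-Real.log (r₂ / r₁)) : ℝ) : ℂ) * (r₂ * cpt θ) = r₁ * cpt θ := by
    rw [Real.exp_neg, Real.exp_log (by positivity), ← mul_assoc, ← Complex.ofReal_mul]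
    congr 2
    field_simp
  rw [hexp, re_mul_cpt_mul, re_mul_cpt_mul] at hmain
  obtain ⟨hcos, hlt⟩ := hsmall r₁ (θ - θ₀) hr₁ (by linarith) hθ
  set σ := Real.log (r₂ / r₁) with hσ
  have hσpos : 0 < σ := Real.log_pos ((one_lt_div hr₁0).2 hr)
  have hσle : r₁ * σ ≤ r₂ - r₁ := by
    have := Real.log_le_sub_one_of_pos (div_pos hr₂0 hr₁0)
    calc r₁ * σ ≤ r₁ * (r₂ / r₁ - 1) := by gcongr
      _ = r₂ - r₁ := by field_simp
  have h3 : r₁ * σ * (K * Real.cos (θ - θ₀)) ≤ (r₂ - r₁) * (K * Real.cos (θ - θ₀)) := by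
    gcongr
  nlinarith [mul_lt_mul_of_pos_right hlt hσpos]

/-- A negative angular derivative near a boundary point makes `f` strictly decreasing in the angle
near that point. -/
lemma IsReHolo.exists_angular_lt {f : ℂ → ℝ} (hf : IsReHolo f)
    (hc : ContinuousOn f (closedBall 0 1)) {g : ℝ → ℝ}
    (hg : ∀ θ : ℝ, HasDerivWithinAt (fun t : ℝ => f (cpt t)) (g θ) (Ici θ) θ)
    (hb : ∀ θ, ∃ M, ∀ᶠ x in nhds θ, g x ≤ M) {θ₀ c : ℝ} (hcpos : 0 < c)
    (h0 : ∀ᶠ x in nhds θ₀, g x ≤ -c) :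
    ∃ δ > 0, ∀ r θ₁ θ₂ : ℝ, 1 - δ < r → r ≤ 1 → |θ₁ - θ₀| < δ → |θ₂ - θ₀| < δ → θ₁ < θ₂ →
      f (r * cpt θ₂) < f (r * cpt θ₁) := by
  obtain ⟨K, -, hK⟩ := exists_cosine_barrier hb h0
  obtain ⟨δ, hδ, hδ1, hsmall⟩ := exists_one_sub_mul_cos_lt K hcpos
  refine ⟨δ, hδ, fun r θ₁ θ₂ hr hr1 hθ₁ hθ₂ hθ => ?_⟩
  have hr0 : 0 < r := by linarith
  have hmain := (hf.add_linear (K * cpt (-θ₀) * -Complex.I)).angular_increment_le (a := K - c)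
    (hc.add (by fun_prop)) (fun z hz => by
      obtain ⟨t, ht, rfl⟩ := exists_cpt_eq θ₀ hz
      have hlin : HasDerivWithinAt
          (fun s : ℝ => (cpt s * (K * cpt (-θ₀) * -Complex.I)).re)
          (K * Real.cos (t - θ₀)) (Ici t) t := by
        have e := fun s => re_mul_cpt_mul_neg_I 1 K s θ₀
        simp only [Complex.ofReal_one, one_mul] at e
        simp only [e]
        have := ((((hasDerivAt_id t).sub_const θ₀).sin).const_mul K).hasDerivWithinAt (s := Ici t)
        simpa using this
      refine ⟨g t + K * Real.cos (t - θ₀), by linarith [hK t ht], ?_⟩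
      have := hasDerivWithinAt_Ici_zero_comp_add.2 ((hg t).add hlin)
      convert this using 3 with s
      simp [cpt_add, mul_comm]) (z := r * cpt θ₁) (by simp [norm_cpt, abs_of_pos hr0, hr1])
    (h := θ₂ - θ₁) (by linarith)
  have hrot : cpt (θ₂ - θ₁) * (r * cpt θ₁) = r * cpt θ₂ := by
    rw [mul_left_comm, ← cpt_add, sub_add_cancel]
  rw [hrot, re_mul_cpt_mul_neg_I, re_mul_cpt_mul_neg_I] at hmain
  obtain ⟨ξ, hξ, hslope⟩ := exists_hasDerivAt_eq_slope Real.sin Real.cos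
    (show θ₁ - θ₀ < θ₂ - θ₀ by linarith) Real.continuous_sin.continuousOn
    (fun x _ => Real.hasDerivAt_sin x)
  rw [eq_div_iff (by linarith)] at hslope
  rw [abs_lt] at hθ₁ hθ₂
  obtain ⟨-, hlt⟩ := hsmall r ξ hr hr1 (abs_lt.2 ⟨by linarith [hξ.1], by linarith [hξ.2]⟩)
  have hs : r * K * Real.sin (θ₂ - θ₀) - r * K * Real.sin (θ₁ - θ₀)
      = r * K * Real.cos ξ * (θ₂ - θ₁) := by
    rw [← mul_sub, ← hslope]; ring
  nlinarith [mul_lt_mul_of_pos_right hlt (sub_pos.2 hθ)]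

lemma HasDerivWithinAt.dotC {ψ : ℝ → ℂ} {v : ℂ} {s : Set ℝ} {x : ℝ}
    (h : HasDerivWithinAt ψ v s x) (u : ℂ) :
    HasDerivWithinAt (fun t => dotC u (ψ t)) (dotC u v) s x :=
  ((Complex.reCLM.hasFDerivAt.comp_hasDerivWithinAt x h).const_mul u.re).add
    ((Complex.imCLM.hasFDerivAt.comp_hasDerivWithinAt x h).const_mul u.im)

lemma continuous_dotC (u : ℂ) : Continuous (dotC u) := by
  unfold dotC; fun_prop

lemma HarmonicOn2.isReHolo_dotC {φ : ℂ → ℂ} (hφ : ContDiffOn ℝ 2 φ (ball 0 1))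
    (h : HarmonicOn2 φ (ball 0 1)) (u : ℂ) : IsReHolo (fun z => dotC u (φ z)) := by
  obtain ⟨F, hF, h1⟩ := isReHolo_of_lap2_eq_zero (f := fun z => (φ z).re)
    (Complex.reCLM.contDiff.comp_contDiffOn hφ) fun z hz => (h z hz).1
  obtain ⟨G, hG, h2⟩ := isReHolo_of_lap2_eq_zero (f := fun z => (φ z).im)
    (Complex.imCLM.contDiff.comp_contDiffOn hφ) fun z hz => (h z hz).2
  exact ⟨fun z => (u.re : ℂ) * F z + (u.im : ℂ) * G z, by fun_prop,
    fun z hz => by simp [dotC, h1 z hz, h2 z hz]⟩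

lemma tendsto_of_tendsto_deriv_nhdsWithin {γ δ : ℝ → ℂ} {v : ℂ} {l : Filter ℝ} (hv : v ≠ 0)
    (h : Tendsto (deriv γ) l (nhds v))
    (hδ : ∀ x d, HasDerivAt γ d x → d = δ x) : Tendsto δ l (nhds v) := by
  refine h.congr' ?_
  filter_upwards [h.eventually_ne hv] with x hx
  exact hδ x _ (differentiableAt_of_deriv_ne_zero hx).hasDerivAt

/-- Near a point, the right derivative along a direction is controlled by both one-sided
derivatives at that point. -/
lemma eventually_dotC_lt {gp gm : ℝ → ℂ} {θ : ℝ}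
    (hp : Tendsto gp (nhdsWithin θ (Ioi θ)) (nhds (gp θ)))
    (hm : Tendsto gp (nhdsWithin θ (Iio θ)) (nhds (gm θ))) {u : ℂ} {a : ℝ}
    (h1 : dotC u (gp θ) < a) (h2 : dotC u (gm θ) < a) :
    ∀ᶠ x in nhds θ, dotC u (gp x) ≤ a := by
  have e1 := (((continuous_dotC u).tendsto _).comp hp).eventually_lt_const h1
  have e2 := (((continuous_dotC u).tendsto _).comp hm).eventually_lt_const h2
  have e3 : ∀ᶠ x in nhdsWithin θ {θ}ᶜ, dotC u (gp x) < a := by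
    rw [← nhdsLT_sup_nhdsGT]
    exact eventually_sup.2 ⟨e2, e1⟩
  rw [eventually_nhdsWithin_iff] at e3
  filter_upwards [e3] with x hx
  by_cases hxθ : x = θ
  · rw [hxθ]; exact h1.le
  · exact (hx hxθ).le

/-- Polar rectangles at a boundary point are neighborhoods of it in the closed disk. -/
lemma exists_nhdsWithin_polar (θ₀ : ℝ) {δ : ℝ} (hδ : 0 < δ) :
    ∃ U ∈ nhdsWithin (cpt θ₀) (closedBall (0 : ℂ) 1), ∀ z ∈ U,
      ∃ r θ : ℝ, z = r * cpt θ ∧ 1 - δ < r ∧ r ≤ 1 ∧ |θ - θ₀| < δ := by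
  have h1 : ∀ᶠ z in nhds (cpt θ₀), 1 - δ < ‖z‖ :=
    continuous_norm.continuousAt.eventually_const_lt (by simp only [norm_cpt]; linarith)
  have hz0 : cpt θ₀ * cpt (-θ₀) = 1 := by rw [← cpt_add]; simp [cpt]
  have h2 : ∀ᶠ z in nhds (cpt θ₀), |(z * cpt (-θ₀)).arg| < δ := by
    have hc : ContinuousAt (fun z => |(z * cpt (-θ₀)).arg|) (cpt θ₀) := by
      refine ContinuousAt.abs (ContinuousAt.comp (g := Complex.arg) ?_ (by fun_prop))
      rw [hz0]
      exact Complex.continuousAt_arg (by simp)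
    exact hc.eventually_lt_const (by simpa [hz0] using hδ)
  refine ⟨_, inter_mem (nhdsWithin_le_nhds (h1.and h2)) self_mem_nhdsWithin, ?_⟩
  rintro z ⟨⟨hz1, hz2⟩, hz3⟩
  refine ⟨‖z‖, θ₀ + (z * cpt (-θ₀)).arg, ?_, hz1, by simpa using hz3, by simpa using hz2⟩
  have h3 := Complex.norm_mul_exp_arg_mul_I (z * cpt (-θ₀))
  rw [norm_mul, norm_cpt, mul_one] at h3
  rw [cpt_add, mul_left_comm]
  change _ = cpt θ₀ * (_ * Complex.exp _)
  rw [h3, mul_left_comm, hz0, mul_one]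

/-- If `v` lies in the open cone determined by `a` and `b`, then two linear functionals, close to
the rotations of `v` by `±π/2`, are positive at `v` and have opposite signs on `a` and `b`. -/
lemma exists_pos_dotC_neg {v a b : ℂ} (hv : v ≠ 0) (ha : 0 < dotC (perpC v) a)
    (hb : 0 < dotC (perpC v) b) :
    ∃ u w : ℂ, 0 < dotC u v ∧ dotC u a < 0 ∧ dotC u b < 0 ∧
      0 < dotC w v ∧ dotC (-w) a < 0 ∧ dotC (-w) b < 0 := by
  have key : ∀ᶠ t : ℝ in nhdsWithin 0 (Ioi 0),
      (t * dotC v a < dotC (perpC v) a ∧ t * dotC v b < dotC (perpC v) b) ∧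
      (t * -dotC v a < dotC (perpC v) a ∧ t * -dotC v b < dotC (perpC v) b) := by
    have aux : ∀ x y : ℝ, 0 < y → ∀ᶠ t : ℝ in nhdsWithin 0 (Ioi 0), t * x < y := fun x y hy =>
      nhdsWithin_le_nhds (ContinuousAt.eventually_lt (f := fun t : ℝ => t * x) (g := fun _ => y)
        (by fun_prop) (by fun_prop) (by simpa using hy))
    exact ((aux _ _ ha).and (aux _ _ hb)).and ((aux _ _ ha).and (aux _ _ hb))
  obtain ⟨t, ⟨⟨h1, h2⟩, h3, h4⟩, ht⟩ := (key.and self_mem_nhdsWithin).exists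
  have hvv : 0 < v.re * v.re + v.im * v.im := by
    have := Complex.normSq_pos.2 hv
    rwa [Complex.normSq_apply] at this
  have hpos : 0 < t * (v.re * v.re + v.im * v.im) := mul_pos ht hvv
  refine ⟨t * v + Complex.I * v, t * v - Complex.I * v, ?_, ?_, ?_, ?_, ?_, ?_⟩ <;>
    simp [dotC, perpC] at h1 h2 h3 h4 ⊢ <;> linarith

/-- Strict monotonicity in polar coordinates of two linear projections of `φ` gives injectivity. -/
lemma injOn_of_polar_lt {φ : ℂ → ℂ} {U : Set ℂ} {δ θ₀ : ℝ} {u w : ℂ}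
    (hU : ∀ z ∈ U, ∃ r θ : ℝ, z = r * cpt θ ∧ 1 - δ < r ∧ r ≤ 1 ∧ |θ - θ₀| < δ)
    (hur : ∀ θ r₁ r₂ : ℝ, |θ - θ₀| < δ → 1 - δ < r₁ → r₁ < r₂ → r₂ ≤ 1 →
      dotC u (φ (r₂ * cpt θ)) < dotC u (φ (r₁ * cpt θ)))
    (hwr : ∀ θ r₁ r₂ : ℝ, |θ - θ₀| < δ → 1 - δ < r₁ → r₁ < r₂ → r₂ ≤ 1 →
      dotC w (φ (r₂ * cpt θ)) < dotC w (φ (r₁ * cpt θ)))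
    (hua : ∀ r θ₁ θ₂ : ℝ, 1 - δ < r → r ≤ 1 → |θ₁ - θ₀| < δ → |θ₂ - θ₀| < δ → θ₁ < θ₂ →
      dotC u (φ (r * cpt θ₂)) < dotC u (φ (r * cpt θ₁)))
    (hwa : ∀ r θ₁ θ₂ : ℝ, 1 - δ < r → r ≤ 1 → |θ₁ - θ₀| < δ → |θ₂ - θ₀| < δ → θ₁ < θ₂ →
      dotC w (φ (r * cpt θ₁)) < dotC w (φ (r * cpt θ₂))) :
    InjOn φ U := by
  have main : ∀ r₁ r₂ θ₁ θ₂ : ℝ, 1 - δ < r₁ → r₁ ≤ r₂ → r₂ ≤ 1 → |θ₁ - θ₀| < δ → |θ₂ - θ₀| < δ →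
      φ (r₁ * cpt θ₁) = φ (r₂ * cpt θ₂) → r₁ = r₂ ∧ θ₁ = θ₂ := by
    intro r₁ r₂ θ₁ θ₂ h1 h12 h2 hθ₁ hθ₂ heq
    have hul : dotC u (φ (r₂ * cpt θ₂)) ≤ dotC u (φ (r₁ * cpt θ₂)) := by
      rcases h12.eq_or_lt with h | h
      · rw [h]
      · exact (hur θ₂ r₁ r₂ hθ₂ h1 h h2).le
    have hwl : dotC w (φ (r₂ * cpt θ₂)) ≤ dotC w (φ (r₁ * cpt θ₂)) := by
      rcases h12.eq_or_lt with h | h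
      · rw [h]
      · exact (hwr θ₂ r₁ r₂ hθ₂ h1 h h2).le
    rw [← heq] at hul hwl
    rcases lt_trichotomy θ₁ θ₂ with h | h | h
    · exact absurd (hua r₁ θ₁ θ₂ h1 (h12.trans h2) hθ₁ hθ₂ h) (not_lt.2 hul)
    · refine ⟨?_, h⟩
      by_contra hne
      have := hur θ₂ r₁ r₂ hθ₂ h1 (lt_of_le_of_ne h12 hne) h2
      rw [← heq, h] at this
      exact lt_irrefl _ this
    · exact absurd (hwa r₁ θ₂ θ₁ h1 (h12.trans h2) hθ₂ hθ₁ h) (not_lt.2 hwl)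
  intro z hz z' hz' heq
  obtain ⟨r, θ, rfl, hr, hr1, hθ⟩ := hU z hz
  obtain ⟨r', θ', rfl, hr', hr1', hθ'⟩ := hU z' hz'
  rcases le_total r r' with h | h
  · obtain ⟨rfl, rfl⟩ := main r r' θ θ' hr h hr1' hθ hθ' heq
    rfl
  · obtain ⟨rfl, rfl⟩ := main r' r θ' θ hr' h hr1 hθ' hθ heq.symm
    rfl

/-- Lemma 5 of the paper. Under the hypotheses of Theorem 4
(same setup as Statement 0) together with the cone condition
`∂φ/∂ν(e^{iθ}) ∈ 𝒞_θ` at every point of ∂𝔹, the harmonic extension `φ` is a local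
homeomorphism around every boundary point `e^{iθ}`: every `e^{iθ}` has a neighborhood
in `cl 𝔹` on which `φ` is injective. -/
theorem cone_condition_implies_local_homeomorphism_at_boundary
    (Ω : Set ℂ) (γ : ℝ → ℂ) (φ : ℂ → ℂ) (S : Set ℂ) (gp gm N : ℝ → ℂ)
    (hΩo : IsOpen Ω) (hΩb : Bornology.IsBounded Ω)
    (hγc : Continuous γ) (hγper : ∀ θ, γ (θ + 2 * Real.pi) = γ θ)
    (hγinj : Set.InjOn γ (Set.Ico 0 (2 * Real.pi)))
    (hγrange : Set.range γ = frontier Ω)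
    (horient : 0 < ∫ θ in (0:ℝ)..(2 * Real.pi), crossC (γ θ) (deriv γ θ))
    (hSfin : S.Finite) (hSsub : S ⊆ sphere (0 : ℂ) 1)
    (hgp : ∀ θ, HasDerivWithinAt γ (gp θ) (Ici θ) θ)
    (hgm : ∀ θ, HasDerivWithinAt γ (gm θ) (Iic θ) θ)
    (hgp0 : ∀ θ, gp θ ≠ 0) (hgm0 : ∀ θ, gm θ ≠ 0)
    (hsmooth : ∀ θ : ℝ, cpt θ ∉ S → ContDiffAt ℝ 1 γ θ)
    (hγ'0 : ∀ θ : ℝ, cpt θ ∉ S → deriv γ θ ≠ 0)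
    (hlimp : ∀ θ : ℝ, cpt θ ∈ S →
      Tendsto (deriv γ) (nhdsWithin θ (Ioi θ)) (nhds (gp θ)))
    (hlimm : ∀ θ : ℝ, cpt θ ∈ S →
      Tendsto (deriv γ) (nhdsWithin θ (Iio θ)) (nhds (gm θ)))
    (hφcont : ContinuousOn φ (closedBall (0 : ℂ) 1))
    (hφC2 : ContDiffOn ℝ 2 φ (ball (0 : ℂ) 1))
    (hφC1 : ContDiffOn ℝ 1 φ (closedBall (0 : ℂ) 1 \ S))
    (hφharm : HarmonicOn2 φ (ball (0 : ℂ) 1))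
    (hφbd : ∀ θ : ℝ, φ (cpt θ) = γ θ)
    (hN : ∀ θ : ℝ,
      HasDerivWithinAt (fun ν : ℝ => φ (((1 - ν : ℝ) : ℂ) * cpt θ)) (N θ) (Ici 0) 0)
    (hNcont : Continuous N) (hN0 : ∀ θ, N θ ≠ 0)
    (hcone : ∀ θ : ℝ, 0 < dotC (perpC (N θ)) (gp θ) ∧ 0 < dotC (perpC (N θ)) (gm θ)) :
    ∀ θ : ℝ, ∃ U ∈ nhdsWithin (cpt θ) (closedBall (0 : ℂ) 1), Set.InjOn φ U := by
  intro θ₀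
  have hgpu : ∀ x d, HasDerivAt γ d x → d = gp x := fun x d h =>
    (uniqueDiffWithinAt_Ici x).eq_deriv _ h.hasDerivWithinAt (hgp x)
  have hgmu : ∀ x d, HasDerivAt γ d x → d = gm x := fun x d h =>
    (uniqueDiffWithinAt_Iic x).eq_deriv _ h.hasDerivWithinAt (hgm x)
  have hderiv : ∀ θ, Tendsto (deriv γ) (nhdsWithin θ (Ioi θ)) (nhds (gp θ)) ∧
      Tendsto (deriv γ) (nhdsWithin θ (Iio θ)) (nhds (gm θ)) := by
    intro θ
    by_cases hS : cpt θ ∈ S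
    · exact ⟨hlimp θ hS, hlimm θ hS⟩
    · have hsm := hsmooth θ hS
      have hder := (hsm.differentiableAt one_ne_zero).hasDerivAt
      have hct : Tendsto (deriv γ) (nhds θ) (nhds (deriv γ θ)) := by
        have := ((hsm.fderiv_right (m := 0) (by norm_num)).continuousAt).clm_apply
          (continuousAt_const (y := (1 : ℝ)))
        exact this
      exact ⟨hgpu θ _ hder ▸ hct.mono_left nhdsWithin_le_nhds,
        hgmu θ _ hder ▸ hct.mono_left nhdsWithin_le_nhds⟩
  have htp := fun θ => tendsto_of_tendsto_deriv_nhdsWithin (hgp0 θ) (hderiv θ).1 hgpu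
  have htm := fun θ => tendsto_of_tendsto_deriv_nhdsWithin (hgm0 θ) (hderiv θ).2 hgpu
  have hcontD : ∀ u, ContinuousOn (fun z => dotC u (φ z)) (closedBall 0 1) := fun u =>
    (continuous_dotC u).comp_continuousOn hφcont
  have hang : ∀ u, dotC u (gp θ₀) < 0 → dotC u (gm θ₀) < 0 → ∃ δ > 0, ∀ r θ₁ θ₂ : ℝ,
      1 - δ < r → r ≤ 1 → |θ₁ - θ₀| < δ → |θ₂ - θ₀| < δ → θ₁ < θ₂ →
      dotC u (φ (r * cpt θ₂)) < dotC u (φ (r * cpt θ₁)) := by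
    intro u h1 h2
    obtain ⟨a, ha, ha0⟩ := exists_between (max_lt h1 h2)
    refine (hφharm.isReHolo_dotC hφC2 u).exists_angular_lt (hcontD u)
      (g := fun θ => dotC u (gp θ)) (c := -a) (fun θ => ?_) (fun θ => ?_) (neg_pos.2 ha0) ?_
    · simp only [hφbd]
      exact (hgp θ).dotC u
    · exact ⟨max (dotC u (gp θ)) (dotC u (gm θ)) + 1, eventually_dotC_lt (htp θ) (htm θ)
        (by linarith [le_max_left (dotC u (gp θ)) (dotC u (gm θ))])
        (by linarith [le_max_right (dotC u (gp θ)) (dotC u (gm θ))])⟩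
    · rw [neg_neg]
      exact eventually_dotC_lt (htp θ₀) (htm θ₀) ((le_max_left _ _).trans_lt ha)
        ((le_max_right _ _).trans_lt ha)
  have hrad : ∀ u, 0 < dotC u (N θ₀) → ∃ δ > 0, ∀ θ r₁ r₂ : ℝ, |θ - θ₀| < δ → 1 - δ < r₁ →
      r₁ < r₂ → r₂ ≤ 1 → dotC u (φ (r₂ * cpt θ)) < dotC u (φ (r₁ * cpt θ)) := fun u h =>
    (hφharm.isReHolo_dotC hφC2 u).exists_radial_lt (hcontD u) (fun θ => (hN θ).dotC u)
      ((continuous_dotC u).comp hNcont) h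
  obtain ⟨u, w, huN, hup, hum, hwN, hwp, hwm⟩ :=
    exists_pos_dotC_neg (hN0 θ₀) (hcone θ₀).1 (hcone θ₀).2
  obtain ⟨δ₁, hδ₁, h₁⟩ := hang u hup hum
  obtain ⟨δ₂, hδ₂, h₂⟩ := hang (-w) hwp hwm
  obtain ⟨δ₃, hδ₃, h₃⟩ := hrad u huN
  obtain ⟨δ₄, hδ₄, h₄⟩ := hrad w hwN
  obtain ⟨δ, hδ, hlt⟩ := exists_between
    (show 0 < min (min (min δ₁ δ₂) (min δ₃ δ₄)) 1 by positivity)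
  simp only [lt_min_iff] at hlt
  obtain ⟨⟨⟨l₁, l₂⟩, l₃, l₄⟩, l₅⟩ := hlt
  obtain ⟨U, hU, hpolar⟩ := exists_nhdsWithin_polar θ₀ hδ
  refine ⟨U, hU, injOn_of_polar_lt hpolar
    (fun θ r₁ r₂ a b c d => h₃ θ r₁ r₂ (a.trans l₃) (by linarith) c d)
    (fun θ r₁ r₂ a b c d => h₄ θ r₁ r₂ (a.trans l₄) (by linarith) c d)
    (fun r θ₁ θ₂ a b c d e => h₁ r θ₁ θ₂ (by linarith) b (c.trans l₁) (d.trans l₁) e)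
    (fun r θ₁ θ₂ a b c d e => ?_)⟩
  have := h₂ r θ₁ θ₂ (by linarith) b (c.trans l₂) (d.trans l₂) e
  simp only [dotC, Complex.neg_re, Complex.neg_im] at this ⊢
  linarith
end
end

section
/- Let γ = (γ₁, γ₂) : ∂𝔹 → ℝ² be a boundary homeomorphism onto a simple closed curve with one-sided derivatives γ'₊ and γ'₋ at e^{i0} that exist, do not vanish, and equal the corresponding one-sided limits of γ', and let φ be its harmonic extension. Suppose the inward normal derivative satisfies ∂φ/∂ν(e^{i0}) = (−λ, 0) for some λ > 0, and the cone condition holds at e^{i0}: ⟨(∂φ/∂ν)^⊥, γ'₊⟩ > 0 and ⟨(∂φ/∂ν)^⊥, γ'₋⟩ > 0. Then there exist δ > 0 and c > 0, with c > min{γ'₊,₂, γ'₋,₂}/2 > 0 (where γ'±,₂ denotes the second coordinate of the one-sided derivative), such that for all s, t ∈ [−δ, δ] with s < t one has γ₂(e^{it}) − γ₂(e^{is}) ≥ c(t − s). -/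
noncomputable section

open Set Metric Filter

/-- If `γ'` has imaginary part above `c > 0` on an open interval, then `Im γ(x) - c x` is
monotone on the corresponding closed interval. -/
theorem monotoneOn_im_sub_mul {γ : ℝ → ℂ} {a b c : ℝ} (hγ : Continuous γ) (hc : 0 < c)
    (h : ∀ x ∈ Ioo a b, c < (deriv γ x).im) :
    MonotoneOn (fun x => (γ x).im - c * x) (Icc a b) := by
  have hd : ∀ x ∈ Ioo a b,
      HasDerivAt (fun x => (γ x).im - c * x) ((deriv γ x).im - c) x := by
    intro x hx
    have hne : deriv γ x ≠ 0 := fun h0 => by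
      have := h x hx
      rw [h0, Complex.zero_im] at this
      linarith
    have hγx := (differentiableAt_of_deriv_ne_zero hne).hasDerivAt
    have him : HasDerivAt (fun x => (γ x).im) (deriv γ x).im x :=
      Complex.imCLM.hasFDerivAt.comp_hasDerivAt x hγx
    simpa using him.fun_sub (hasDerivAt_const_mul (x := x) c)
  refine monotoneOn_of_deriv_nonneg (convex_Icc a b) (by fun_prop) ?_ ?_ <;>
    rw [interior_Icc] <;> intro x hx
  · exact (hd x hx).differentiableAt.differentiableWithinAt
  · rw [(hd x hx).deriv]
    linarith [h x hx]

/-- Lemma 6 of the paper, local monotonicity. `γ` is a boundary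
homeomorphism onto a simple closed curve (continuous, `2π`-periodic, injective on a period),
with one-sided derivatives `gp, gm` at `e^{i0}` (i.e. at the angle `θ = 0`) that exist, do
not vanish and equal the one-sided limits of `γ'`; `φ` is its harmonic extension. If the
inward normal derivative at `e^{i0}` is `∂φ/∂ν(e^{i0}) = (-λ, 0)` with `λ > 0` and the cone
condition `⟨(∂φ/∂ν)^⊥, γ'₊⟩ > 0`, `⟨(∂φ/∂ν)^⊥, γ'₋⟩ > 0` holds at `e^{i0}`, then there are
`δ > 0` and `c > 0` with `c > min(γ'₊,₂, γ'₋,₂)/2 > 0` such that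
`γ₂(e^{it}) - γ₂(e^{is}) ≥ c (t - s)` for all `s < t` in `[-δ, δ]`. -/
theorem cone_condition_implies_local_monotonicity
    (γ : ℝ → ℂ) (φ : ℂ → ℂ) (gp gm : ℂ) (lam : ℝ)
    (hγc : Continuous γ) (hγper : ∀ θ, γ (θ + 2 * Real.pi) = γ θ)
    (hγinj : Set.InjOn γ (Set.Ico 0 (2 * Real.pi)))
    (hgp : HasDerivWithinAt γ gp (Ici (0:ℝ)) 0) (hgp0 : gp ≠ 0)
    (hgm : HasDerivWithinAt γ gm (Iic (0:ℝ)) 0) (hgm0 : gm ≠ 0)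
    (hlimp : Tendsto (deriv γ) (nhdsWithin 0 (Ioi (0:ℝ))) (nhds gp))
    (hlimm : Tendsto (deriv γ) (nhdsWithin 0 (Iio (0:ℝ))) (nhds gm))
    (hφcont : ContinuousOn φ (closedBall (0 : ℂ) 1))
    (hφC2 : ContDiffOn ℝ 2 φ (ball (0 : ℂ) 1))
    (hφharm : HarmonicOn2 φ (ball (0 : ℂ) 1))
    (hφbd : ∀ θ : ℝ, φ (cpt θ) = γ θ)
    (hlam : 0 < lam)
    (hN : HasDerivWithinAt (fun ν : ℝ => φ (((1 - ν : ℝ) : ℂ) * cpt 0))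
      ((-lam : ℝ) : ℂ) (Ici 0) 0)
    (hconep : 0 < dotC (perpC ((-lam : ℝ) : ℂ)) gp)
    (hconem : 0 < dotC (perpC ((-lam : ℝ) : ℂ)) gm) :
    ∃ δ > (0:ℝ), ∃ c > (0:ℝ), min gp.im gm.im / 2 < c ∧ 0 < min gp.im gm.im / 2 ∧
      ∀ s t : ℝ, s ∈ Icc (-δ) δ → t ∈ Icc (-δ) δ → s < t →
        c * (t - s) ≤ (γ t).im - (γ s).im := by
  have hp : 0 < gp.im := by
    simp only [dotC, perpC] at hconep
    simp at hconep
    exact pos_of_mul_pos_right hconep hlam.le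
  have hm : 0 < gm.im := by
    simp only [dotC, perpC] at hconem
    simp at hconem
    exact pos_of_mul_pos_right hconem hlam.le
  set m := min gp.im gm.im with hm_def
  have hm0 : 0 < m := lt_min hp hm
  have hmp : m ≤ gp.im := min_le_left _ _
  have hmm : m ≤ gm.im := min_le_right _ _
  have hevp : ∀ᶠ x in nhdsWithin 0 (Ioi (0:ℝ)), 3 / 4 * m < (deriv γ x).im :=
    ((Complex.continuous_im.tendsto gp).comp hlimp).eventually_const_lt (by linarith)
  have hevm : ∀ᶠ x in nhdsWithin 0 (Iio (0:ℝ)), 3 / 4 * m < (deriv γ x).im :=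
    ((Complex.continuous_im.tendsto gm).comp hlimm).eventually_const_lt (by linarith)
  obtain ⟨b, hb, hbsub⟩ := mem_nhdsGT_iff_exists_Ioo_subset.1 hevp
  obtain ⟨a, ha, hasub⟩ := mem_nhdsLT_iff_exists_Ioo_subset.1 hevm
  have hb0 : 0 < b := hb
  have ha0 : a < 0 := ha
  have hmono : MonotoneOn (fun x => (γ x).im - 3 / 4 * m * x) (Icc a b) := by
    rw [← Icc_union_Icc_eq_Icc ha0.le hb0.le]
    exact (monotoneOn_im_sub_mul hγc (by linarith) hasub).union_right
      (monotoneOn_im_sub_mul hγc (by linarith) hbsub) (isGreatest_Icc ha0.le) (isLeast_Icc hb0.le)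
  refine ⟨min (-a) b, lt_min (by linarith) hb0, 3 / 4 * m, by linarith, by linarith,
    by linarith, ?_⟩
  intro s t hs ht hst
  have h1 := min_le_left (-a) b
  have h2 := min_le_right (-a) b
  have hst' := hmono (a := s) (b := t) ⟨by linarith [hs.1], by linarith [hs.2]⟩
    ⟨by linarith [ht.1], by linarith [ht.2]⟩ hst.le
  simp only at hst'
  linarith
end
end

section
/- Let f : [−π, π] → ℝ (identified with a function on the unit circle, 2π-periodic) be measurable with |f(t)| ≤ M for all t, and suppose there exist δ > 0 and c > 0 such that f(t) − f(s) ≥ c(t − s) for all s < t in [−δ, δ]. Let F : 𝔹 → ℝ be the Poisson (harmonic) extension F(r e^{it}) = (1/2π) ∫_{−π}^{π} P_r(t − t') f(t') dt', where P_r(θ) = (1 − r²)/(r² + 1 − 2r cos θ). Then there exists R < 1 such that for all r ∈ (R, 1) and all s, t ∈ [−δ/8, δ/8] with s < t, one has F(r e^{it}) − F(r e^{is}) ≥ (c/2)(t − s). -/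
noncomputable section

open Set

/-- The Poisson kernel for the unit disk: `P_r(θ) = (1 - r²)/(r² + 1 - 2 r cos θ)`. -/
def poissonKer (r θ : ℝ) : ℝ := (1 - r ^ 2) / (r ^ 2 + 1 - 2 * r * Real.cos θ)

/-- The Poisson (harmonic) extension of a boundary function `f` (as a function of the
angular parameter), evaluated at the point `r e^{it}` of the unit disk:
`F(r e^{it}) = (1/2π) ∫_{-π}^{π} P_r(t - t') f(t') dt'`. -/
def poissonExtAngular (f : ℝ → ℝ) (r t : ℝ) : ℝ :=
  (1 / (2 * Real.pi)) * ∫ t' in (-Real.pi)..Real.pi, poissonKer r (t - t') * f t'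

open MeasureTheory intervalIntegral

lemma poissonKer_denom_pos {r : ℝ} (hr0 : 0 ≤ r) (hr1 : r < 1) (θ : ℝ) :
    0 < r ^ 2 + 1 - 2 * r * Real.cos θ := by
  nlinarith [mul_nonneg hr0 (sub_nonneg.2 (Real.cos_le_one θ)),
    mul_pos (sub_pos.2 hr1) (sub_pos.2 hr1)]

lemma poissonKer_nonneg {r : ℝ} (hr0 : 0 ≤ r) (hr1 : r < 1) (θ : ℝ) : 0 ≤ poissonKer r θ :=
  div_nonneg (by nlinarith) (poissonKer_denom_pos hr0 hr1 θ).le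

lemma continuous_poissonKer {r : ℝ} (hr0 : 0 ≤ r) (hr1 : r < 1) : Continuous (poissonKer r) := by
  unfold poissonKer
  exact Continuous.div (by fun_prop) (by fun_prop) fun θ => (poissonKer_denom_pos hr0 hr1 θ).ne'

lemma poissonKer_periodic (r : ℝ) : Function.Periodic (poissonKer r) (2 * Real.pi) := by
  intro θ
  simp [poissonKer]

lemma poissonKer_eq_poissonKernel (r θ : ℝ) :
    poissonKer r θ = poissonKernel 0 (r : ℂ) (circleMap 0 1 θ) := by
  have h : ‖circleMap 0 1 θ - (r : ℂ)‖ ^ 2 = r ^ 2 + 1 - 2 * r * Real.cos θ := by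
    rw [← Complex.normSq_eq_norm_sq, Complex.normSq_apply]
    simp [circleMap, Complex.exp_ofReal_mul_I_re, Complex.exp_ofReal_mul_I_im]
    nlinarith [Real.sin_sq_add_cos_sq θ]
  simp [poissonKer, poissonKernel, h]

lemma integral_poissonKer {r : ℝ} (hr0 : 0 ≤ r) (hr1 : r < 1) (a : ℝ) :
    ∫ θ in a..(a + 2 * Real.pi), poissonKer r θ = 2 * Real.pi := by
  have hw : (r : ℂ) ∈ Metric.ball (0 : ℂ) 1 := by simpa [abs_of_nonneg hr0] using hr1
  have h := InnerProductSpace.HarmonicOnNhd.circleAverage_poissonKernel_smul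
    (f := fun _ : ℂ => (1 : ℝ)) (c := 0) (R := 1) (w := (r : ℂ))
    (fun x _ => InnerProductSpace.harmonicAt_const _) hw
  rw [Real.circleAverage_def] at h
  simp only [Pi.smul_apply', smul_eq_mul, mul_one, ← poissonKer_eq_poissonKernel] at h
  rw [(poissonKer_periodic r).intervalIntegral_add_eq a 0, zero_add]
  field_simp at h
  linarith

lemma le_poissonKer_denom {r κ θ : ℝ} (hr : 1 / 2 ≤ r) (hκ : 0 < κ) (hθ : Real.cos θ ≤ 1 - κ) :
    κ ≤ r ^ 2 + 1 - 2 * r * Real.cos θ := by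
  nlinarith [sq_nonneg (1 - r), mul_nonneg (sub_nonneg.2 hr) hκ.le,
    mul_nonneg (by linarith : (0 : ℝ) ≤ r) (sub_nonneg.2 hθ)]

lemma poissonKer_le {r κ θ : ℝ} (hr : 1 / 2 ≤ r) (hr1 : r < 1) (hκ : 0 < κ)
    (hθ : Real.cos θ ≤ 1 - κ) : poissonKer r θ ≤ (1 - r ^ 2) / κ :=
  div_le_div_of_nonneg_left (by nlinarith) hκ (le_poissonKer_denom hr hκ hθ)

lemma abs_poissonKer_sub_le {r κ x y : ℝ} (hr : 1 / 2 ≤ r) (hr1 : r < 1) (hκ : 0 < κ)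
    (hx : Real.cos x ≤ 1 - κ) (hy : Real.cos y ≤ 1 - κ) :
    |poissonKer r x - poissonKer r y| ≤ 2 * (1 - r ^ 2) / κ ^ 2 * |x - y| := by
  have hdx := le_poissonKer_denom hr hκ hx
  have hdy := le_poissonKer_denom hr hκ hy
  have h0 : 0 ≤ 1 - r ^ 2 := by nlinarith
  have hdx0 := hκ.trans_le hdx
  have hdy0 := hκ.trans_le hdy
  have key : poissonKer r x - poissonKer r y = (1 - r ^ 2) * (2 * r) * (Real.cos x - Real.cos y) /
      ((r ^ 2 + 1 - 2 * r * Real.cos x) * (r ^ 2 + 1 - 2 * r * Real.cos y)) := by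
    unfold poissonKer
    rw [div_sub_div _ _ hdx0.ne' hdy0.ne']
    congr 1
    ring
  rw [key, abs_div, abs_mul, abs_of_pos (mul_pos hdx0 hdy0), abs_of_nonneg (by positivity),
    div_mul_eq_mul_div]
  apply div_le_div₀
  · positivity
  · apply mul_le_mul _ (Real.abs_cos_sub_cos_le x y) (abs_nonneg _) (by positivity)
    nlinarith
  · positivity
  · rw [sq]
    exact mul_le_mul hdx hdy hκ.le hdx0.le

lemma cos_le_cos_of_mem_Icc_two_pi_sub {b u : ℝ} (hb0 : 0 ≤ b) (hu : u ∈ Icc b (2 * Real.pi - b)) :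
    Real.cos u ≤ Real.cos b := by
  rcases le_total u Real.pi with h | h
  · exact Real.cos_le_cos_of_nonneg_of_le_pi hb0 h hu.1
  · rw [← Real.cos_two_pi_sub u]
    exact Real.cos_le_cos_of_nonneg_of_le_pi hb0 (by linarith) (by linarith [hu.2])

/-- Lower bound for the increments of the convolution of a nonnegative periodic kernel
concentrated near `0` with a bounded function that increases with slope at least `c`
near `0`. -/
lemma le_convolution_sub {K f : ℝ → ℝ} {M c e ε L s t : ℝ}
    (hK : Continuous K) (hKper : Function.Periodic K (2 * Real.pi)) (hK0 : ∀ u, 0 ≤ K u)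
    (hKint : ∀ a, ∫ u in a..(a + 2 * Real.pi), K u = 2 * Real.pi)
    (hKε : ∀ u ∈ Icc (3 * e) (2 * Real.pi - 3 * e), K u ≤ ε)
    (hKL : ∀ u ∈ Icc (3 * e) (2 * Real.pi - 3 * e), ∀ v ∈ Icc (3 * e) (2 * Real.pi - 3 * e),
      |K u - K v| ≤ L * |u - v|)
    (hf : Measurable f) (hfper : Function.Periodic f (2 * Real.pi)) (hbd : ∀ t, |f t| ≤ M)
    (he : 0 < e) (heπ : 8 * e < Real.pi) (hc : 0 < c)
    (hmono : ∀ x y : ℝ, x ∈ Icc (-(8 * e)) (8 * e) → y ∈ Icc (-(8 * e)) (8 * e) → x < y →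
      c * (y - x) ≤ f y - f x)
    (hs : -e ≤ s) (ht : t ≤ e) (hst : s < t) :
    (c * (2 * Real.pi - ε * (2 * Real.pi)) - 2 * (ε * M) - L * M * (2 * Real.pi)) * (t - s) ≤
      (∫ w in (-Real.pi)..Real.pi, K (t - w) * f w) -
        ∫ w in (-Real.pi)..Real.pi, K (s - w) * f w := by
  have hπ := Real.pi_pos
  have hM : 0 ≤ M := (abs_nonneg _).trans (hbd 0)
  have hε : 0 ≤ ε := (hK0 (3 * e)).trans (hKε _ ⟨le_rfl, by linarith⟩)
  have hL : 0 ≤ L := by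
    have h := (abs_nonneg _).trans (hKL (3 * e) ⟨le_rfl, by linarith⟩ (4 * e)
      ⟨by linarith, by linarith⟩)
    exact nonneg_of_mul_nonneg_left h (abs_pos.2 (by linarith))
  have hfi : ∀ a b, IntervalIntegrable f volume a b := fun a b =>
    (intervalIntegrable_const (c := M)).mono_fun' hf.aestronglyMeasurable
      (Filter.Eventually.of_forall hbd)
  have hfi' : ∀ x a b, IntervalIntegrable (fun u => f (x - u)) volume a b := fun x a b =>
    (intervalIntegrable_const (c := M)).mono_fun'
      (hf.comp (measurable_const.sub measurable_id)).aestronglyMeasurable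
      (Filter.Eventually.of_forall fun u => hbd (x - u))
  have hi : ∀ x a b, IntervalIntegrable (fun w => K (x - w) * f w) volume a b := fun x a b =>
    (hfi a b).continuousOn_mul (by fun_prop)
  have hi' : ∀ x a b, IntervalIntegrable (fun u => K u * f (x - u)) volume a b := fun x a b =>
    (hfi' x a b).continuousOn_mul (by fun_prop)
  have hsplit : ∀ x, ∫ w in (-Real.pi)..Real.pi, K (x - w) * f w =
      (∫ u in (x - 4 * e)..(x + 4 * e), K u * f (x - u)) +
        ∫ w in (4 * e)..(2 * Real.pi - 4 * e), K (x - w) * f w := by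
    intro x
    have hp : Function.Periodic (fun w => K (x - w) * f w) (2 * Real.pi) := by
      intro w
      simp only [hfper w]
      rw [← hKper (x - (w + 2 * Real.pi))]
      congr 2
      ring
    have h1 := hp.intervalIntegral_add_eq (-Real.pi) (-(4 * e))
    rw [show -Real.pi + 2 * Real.pi = Real.pi by ring,
      show -(4 * e) + 2 * Real.pi = 2 * Real.pi - 4 * e by ring] at h1
    rw [h1, ← integral_add_adjacent_intervals (hi x _ (4 * e)) (hi x _ _)]
    congr 1
    have h2 := integral_comp_sub_left (a := -(4 * e)) (b := 4 * e)
      (fun u => K u * f (x - u)) x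
    simp only [sub_sub_cancel, sub_neg_eq_add] at h2
    exact h2
  have hfar : |(∫ w in (4 * e)..(2 * Real.pi - 4 * e), K (t - w) * f w) -
      ∫ w in (4 * e)..(2 * Real.pi - 4 * e), K (s - w) * f w| ≤
      L * M * (2 * Real.pi) * (t - s) := by
    rw [← integral_sub (hi _ _ _) (hi _ _ _)]
    have h := norm_integral_le_of_norm_le_const (a := 4 * e) (b := 2 * Real.pi - 4 * e)
      (f := fun w => K (t - w) * f w - K (s - w) * f w) (C := L * (t - s) * M) (by
        intro w hw
        rw [uIoc_of_le (by linarith)] at hw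
        have h1 := hKL (t - w + 2 * Real.pi) ⟨by linarith [hw.2], by linarith [hw.1]⟩
          (s - w + 2 * Real.pi) ⟨by linarith [hw.2], by linarith [hw.1]⟩
        rw [hKper, hKper, show t - w + 2 * Real.pi - (s - w + 2 * Real.pi) = t - s by ring,
          abs_of_pos (sub_pos.2 hst)] at h1
        rw [← sub_mul, Real.norm_eq_abs, abs_mul]
        exact mul_le_mul h1 (hbd w) (abs_nonneg _) ((abs_nonneg _).trans h1))
    rw [Real.norm_eq_abs, abs_of_nonneg (by linarith : 0 ≤ 2 * Real.pi - 4 * e - 4 * e)] at h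
    refine h.trans ?_
    have h2 : 0 ≤ L * (t - s) * M := mul_nonneg (mul_nonneg hL (by linarith)) hM
    nlinarith
  have hright : |∫ u in (s + 4 * e)..(t + 4 * e), K u * f (t - u)| ≤ ε * M * (t - s) := by
    have h := norm_integral_le_of_norm_le_const (a := s + 4 * e) (b := t + 4 * e)
      (f := fun u => K u * f (t - u)) (C := ε * M) (by
        intro u hu
        rw [uIoc_of_le (by linarith)] at hu
        rw [Real.norm_eq_abs, abs_mul, abs_of_nonneg (hK0 u)]
        exact mul_le_mul (hKε u ⟨by linarith [hu.1], by linarith [hu.2]⟩) (hbd _)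
          (abs_nonneg _) hε)
    rwa [Real.norm_eq_abs, abs_of_nonneg (by linarith : 0 ≤ t + 4 * e - (s + 4 * e)),
      add_sub_add_right_eq_sub] at h
  have hleft : |∫ u in (s - 4 * e)..(t - 4 * e), K u * f (s - u)| ≤ ε * M * (t - s) := by
    have h := norm_integral_le_of_norm_le_const (a := s - 4 * e) (b := t - 4 * e)
      (f := fun u => K u * f (s - u)) (C := ε * M) (by
        intro u hu
        rw [uIoc_of_le (by linarith)] at hu
        rw [Real.norm_eq_abs, abs_mul, abs_of_nonneg (hK0 u), ← hKper u]
        exact mul_le_mul (hKε _ ⟨by linarith [hu.1], by linarith [hu.2]⟩) (hbd _)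
          (abs_nonneg _) hε)
    rwa [Real.norm_eq_abs, abs_of_nonneg (by linarith : 0 ≤ t - 4 * e - (s - 4 * e)),
      sub_sub_sub_cancel_right] at h
  have hmass : 2 * Real.pi - ε * (2 * Real.pi) ≤ ∫ u in (t - 4 * e)..(s + 4 * e), K u := by
    have h1 : ∫ u in (s + 4 * e)..(t - 4 * e + 2 * Real.pi), K u ≤
        ∫ _ in (s + 4 * e)..(t - 4 * e + 2 * Real.pi), ε :=
      integral_mono_on (by linarith) (hK.intervalIntegrable _ _) intervalIntegrable_const
        fun u hu => hKε u ⟨by linarith [hu.1], by linarith [hu.2]⟩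
    rw [intervalIntegral.integral_const, smul_eq_mul] at h1
    have h2 := integral_add_adjacent_intervals (μ := volume)
      (hK.intervalIntegrable (t - 4 * e) (s + 4 * e))
      (hK.intervalIntegrable (s + 4 * e) (t - 4 * e + 2 * Real.pi))
    rw [hKint] at h2
    nlinarith
  have hmain : c * (t - s) * ∫ u in (t - 4 * e)..(s + 4 * e), K u ≤
      (∫ u in (t - 4 * e)..(s + 4 * e), K u * f (t - u)) -
        ∫ u in (t - 4 * e)..(s + 4 * e), K u * f (s - u) := by
    rw [← integral_sub (hi' _ _ _) (hi' _ _ _), ← intervalIntegral.integral_const_mul]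
    refine integral_mono_on (by linarith) ((hK.intervalIntegrable _ _).const_mul _)
      ((hi' _ _ _).sub (hi' _ _ _)) fun u hu => ?_
    have h := hmono (s - u) (t - u) ⟨by linarith [hu.2], by linarith [hu.1]⟩
      ⟨by linarith [hu.2], by linarith [hu.1]⟩ (by linarith)
    rw [sub_sub_sub_cancel_right] at h
    rw [← mul_sub, mul_comm]
    exact mul_le_mul_of_nonneg_left h (hK0 u)
  have hmass' := mul_le_mul_of_nonneg_left hmass (mul_pos hc (sub_pos.2 hst)).le
  rw [hsplit t, hsplit s,
    ← integral_add_adjacent_intervals (hi' t (t - 4 * e) (s + 4 * e)) (hi' t _ (t + 4 * e)),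
    ← integral_add_adjacent_intervals (hi' s (s - 4 * e) (t - 4 * e)) (hi' s _ (s + 4 * e))]
  linarith [(abs_le.1 hfar).1, (abs_le.1 hright).1, (abs_le.1 hleft).2]

/-- Lemma 7 of the paper. If `f : [-π, π] → ℝ` (a `2π`-periodic function
on the circle) is measurable, bounded by `M`, and satisfies `f(t) - f(s) ≥ c (t - s)` for
all `s < t` in `[-δ, δ]`, then there is `R < 1` such that for all `r ∈ (R, 1)` and all
`s < t` in `[-δ/8, δ/8]` the Poisson extension satisfies
`F(r e^{it}) - F(r e^{is}) ≥ (c/2)(t - s)`. -/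
theorem poisson_extension_preserves_local_monotonicity
    (f : ℝ → ℝ) (M c δ : ℝ)
    (hmeas : Measurable f) (hper : ∀ t, f (t + 2 * Real.pi) = f t)
    (hbd : ∀ t, |f t| ≤ M)
    (hδ : 0 < δ) (hc : 0 < c)
    (hmono : ∀ s t : ℝ, s ∈ Icc (-δ) δ → t ∈ Icc (-δ) δ → s < t →
      c * (t - s) ≤ f t - f s) :
    ∃ R : ℝ, R < 1 ∧ ∀ r : ℝ, R < r → r < 1 →
      ∀ s t : ℝ, s ∈ Icc (-(δ / 8)) (δ / 8) → t ∈ Icc (-(δ / 8)) (δ / 8) → s < t →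
        (c / 2) * (t - s) ≤ poissonExtAngular f r t - poissonExtAngular f r s := by
  have hπ := Real.pi_pos
  have hδπ : δ < Real.pi := by
    by_contra! h
    have h1 := hmono (-Real.pi) Real.pi ⟨by linarith, by linarith⟩ ⟨by linarith, h⟩ (by linarith)
    have h2 := hper (-Real.pi)
    rw [show -Real.pi + 2 * Real.pi = Real.pi by ring] at h2
    have h3 : 0 < c * (Real.pi - -Real.pi) := mul_pos hc (by linarith)
    linarith
  set κ : ℝ := 1 - Real.cos (3 * (δ / 8)) with hκdef
  have hκ : 0 < κ := by
    have h := Real.cos_lt_cos_of_nonneg_of_le_pi (x := 0) (y := 3 * (δ / 8)) le_rfl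
      (by linarith) (by linarith)
    rw [Real.cos_zero] at h
    linarith
  have htend : Filter.Tendsto (fun r : ℝ => c * (2 * Real.pi - (1 - r ^ 2) / κ * (2 * Real.pi)) -
      2 * ((1 - r ^ 2) / κ * M) - 2 * (1 - r ^ 2) / κ ^ 2 * M * (2 * Real.pi))
      (nhds 1) (nhds (c * (2 * Real.pi))) := by
    refine Continuous.tendsto' (by fun_prop) _ _ (by simp)
  have hev := htend.eventually (lt_mem_nhds (show c * Real.pi < c * (2 * Real.pi) by nlinarith))
  obtain ⟨η, hη, hball⟩ := Metric.eventually_nhds_iff.1 hev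
  refine ⟨max (1 / 2) (1 - η), max_lt (by norm_num) (by linarith), ?_⟩
  intro r hRr hr1 s t hs ht hst
  obtain ⟨hr, hrη⟩ := max_lt_iff.1 hRr
  have hr0 : 0 ≤ r := by linarith
  have hcoef := hball (y := r) (by rw [Real.dist_eq, abs_lt]; constructor <;> linarith)
  have hcos : ∀ u ∈ Icc (3 * (δ / 8)) (2 * Real.pi - 3 * (δ / 8)), Real.cos u ≤ 1 - κ := by
    intro u hu
    rw [hκdef, sub_sub_cancel]
    exact cos_le_cos_of_mem_Icc_two_pi_sub (by linarith) hu
  have h8 : 8 * (δ / 8) = δ := by ring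
  have key := le_convolution_sub (c := c) (continuous_poissonKer hr0 hr1) (poissonKer_periodic r)
    (poissonKer_nonneg hr0 hr1) (integral_poissonKer hr0 hr1)
    (fun u hu => poissonKer_le hr.le hr1 hκ (hcos u hu))
    (fun u hu v hv => abs_poissonKer_sub_le hr.le hr1 hκ (hcos u hu) (hcos v hv))
    hmeas hper hbd (by linarith) (by linarith) hc (by rwa [h8]) hs.1 ht.2 hst
  have hlow := (mul_le_mul_of_nonneg_right hcoef.le (sub_pos.2 hst).le).trans key
  rw [poissonExtAngular, poissonExtAngular, ← mul_sub, one_div, ← div_eq_inv_mul,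
    le_div_iff₀ (by positivity)]
  linarith
end
end

section
/- (Radó–Kneser–Choquet) Let γ : ∂𝔹 → Γ be a homeomorphism of the unit circle onto a simple closed curve Γ = ∂Ω enclosing a bounded set Ω ⊂ ℝ², and let φ be the harmonic extension of γ (the solution of Δφ = 0 in 𝔹 with φ = γ on ∂𝔹). If Ω is convex, then φ is a homeomorphism of cl(𝔹) onto cl(Ω). -/
noncomputable section

open Set Metric Filter

section

open InnerProductSpace Complex

theorem circleAverage_pos_of_nonneg {h : ℂ → ℝ} (hc : ContinuousOn h (sphere 0 1))
    (hn : ∀ w ∈ sphere (0 : ℂ) 1, 0 ≤ h w) {w₀ : ℂ} (hw₀ : w₀ ∈ sphere (0 : ℂ) 1)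
    (hp : 0 < h w₀) : 0 < Real.circleAverage h 0 1 := by
  have hmem : ∀ θ, circleMap 0 1 θ ∈ sphere (0 : ℂ) 1 := fun θ =>
    circleMap_mem_sphere _ zero_le_one _
  obtain ⟨θ₀, hθ₀, rfl⟩ : w₀ ∈ circleMap 0 1 '' Ioc 0 (2 * Real.pi) := by
    rw [image_circleMap_Ioc]; simpa using hw₀
  rw [Real.circleAverage, smul_eq_mul]
  refine mul_pos (by positivity) (intervalIntegral.integral_pos Real.two_pi_pos ?_
    (fun θ _ => hn _ (hmem θ)) ⟨θ₀, Ioc_subset_Icc_self hθ₀, hp⟩)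
  exact (hc.comp (continuous_circleMap 0 1).continuousOn fun θ _ => hmem θ)

theorem laplacian_eq_lap2 {f : ℂ → ℝ} {z : ℂ} (hf : ContDiffAt ℝ 2 f z) :
    Laplacian.laplacian f z = lap2 f z := by
  have hd : DifferentiableAt ℝ (fderiv ℝ f) z :=
    (hf.fderiv_right (m := 1) (by norm_num)).differentiableAt one_ne_zero
  rw [laplacian_eq_iteratedFDeriv_complexPlane, lap2]
  simp only [iteratedFDeriv_two_apply]
  rw [fderiv_clm_apply hd (by fun_prop), fderiv_clm_apply hd (by fun_prop)]
  simp

theorem harmonicOnNhd_of_re_im {φ : ℂ → ℂ} {s : Set ℂ}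
    (hre : HarmonicOnNhd (fun w => (φ w).re) s) (him : HarmonicOnNhd (fun w => (φ w).im) s) :
    HarmonicOnNhd φ s := by
  convert (hre.comp_CLM ofRealCLM).add (him.comp_CLM (ofRealCLM.smulRight I)) using 1
  ext w
  simp

theorem HarmonicOn2.harmonicOnNhd {φ : ℂ → ℂ} {s : Set ℂ} (hs : IsOpen s)
    (hd : ContDiffOn ℝ 2 φ s) (h : HarmonicOn2 φ s) : HarmonicOnNhd φ s := by
  have hda : ∀ z ∈ s, ContDiffAt ℝ 2 φ z := fun z hz => hd.contDiffAt (hs.mem_nhds hz)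
  have key : ∀ l : ℂ →L[ℝ] ℝ, (∀ z ∈ s, lap2 (l ∘ φ) z = 0) → HarmonicOnNhd (l ∘ φ) s := by
    intro l hl z hz
    refine ⟨l.contDiff.contDiffAt.comp z (hda z hz), ?_⟩
    filter_upwards [hs.mem_nhds hz] with w hw
    rw [laplacian_eq_lap2 (l.contDiff.contDiffAt.comp w (hda w hw)), hl w hw]
    rfl
  exact harmonicOnNhd_of_re_im (key reCLM fun z hz => (h z hz).1) (key imCLM fun z hz => (h z hz).2)

theorem harmonicOnNhd_comp_of_analyticOnNhd {f : ℂ → ℝ} {M : ℂ → ℂ}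
    (hf : HarmonicOnNhd f (ball 0 1)) (hM : AnalyticOnNhd ℂ M (ball 0 1))
    (hmaps : MapsTo M (ball 0 1) (ball 0 1)) : HarmonicOnNhd (f ∘ M) (ball 0 1) := by
  obtain ⟨F, hF, hFf⟩ := hf.exists_analyticOnNhd_ball_re_eq
  intro z hz
  have h1 : HarmonicAt (fun w => (F (M w)).re) z :=
    ((hF _ (hmaps hz)).comp (hM z hz)).harmonicAt_re
  refine (harmonicAt_congr_nhds ?_).1 h1
  filter_upwards [isOpen_ball.mem_nhds hz] with w hw
  exact hFf (hmaps hw)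

/-- The disk automorphism `w ↦ (w + a) / (1 + conj a * w)`. -/
def diskAut (a w : ℂ) : ℂ := (w + a) / (1 + (starRingEnd ℂ) a * w)

theorem diskAut_denom_ne_zero {a w : ℂ} (ha : ‖a‖ < 1) (hw : ‖w‖ ≤ 1) :
    1 + (starRingEnd ℂ) a * w ≠ 0 := by
  intro h
  have h1 : (starRingEnd ℂ) a * w = -1 := by linear_combination h
  have h2 : ‖a‖ * ‖w‖ = 1 := by simpa using congrArg norm h1
  nlinarith [norm_nonneg a, norm_nonneg w]

theorem diskAut_neg_diskAut {a w : ℂ} (ha : ‖a‖ < 1) (hw : ‖w‖ ≤ 1) :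
    diskAut (-a) (diskAut a w) = w := by
  have h1 := diskAut_denom_ne_zero ha hw
  have h2 : 1 - (starRingEnd ℂ) a * a ≠ 0 := by
    have := diskAut_denom_ne_zero (a := -a) (w := a) (by simpa using ha) ha.le
    simpa [sub_eq_add_neg] using this
  have h3 : 1 + (starRingEnd ℂ) (-a) * ((w + a) / (1 + (starRingEnd ℂ) a * w)) =
      (1 - (starRingEnd ℂ) a * a) / (1 + (starRingEnd ℂ) a * w) := by
    rw [map_neg]; field_simp; ring
  rw [diskAut, diskAut, h3, div_eq_iff (div_ne_zero h2 h1), ← mul_div_assoc,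
    eq_div_iff h1, add_mul, div_mul_cancel₀ _ h1]
  ring

theorem norm_sq_diskAut_denom_sub (a w : ℂ) :
    ‖1 + (starRingEnd ℂ) a * w‖ ^ 2 - ‖w + a‖ ^ 2 = (1 - ‖a‖ ^ 2) * (1 - ‖w‖ ^ 2) := by
  simp only [← normSq_eq_norm_sq, normSq_apply]
  simp
  ring

theorem norm_diskAut_lt_one {a w : ℂ} (ha : ‖a‖ < 1) (hw : ‖w‖ < 1) : ‖diskAut a w‖ < 1 := by
  rw [diskAut, norm_div, div_lt_one (norm_pos_iff.2 (diskAut_denom_ne_zero ha hw.le))]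
  refine lt_of_pow_lt_pow_left₀ 2 (norm_nonneg _) ?_
  have := norm_sq_diskAut_denom_sub a w
  nlinarith [mul_pos (show 0 < 1 - ‖a‖ ^ 2 by nlinarith [norm_nonneg a])
    (show 0 < 1 - ‖w‖ ^ 2 by nlinarith [norm_nonneg w])]

theorem norm_diskAut_eq_one {a w : ℂ} (ha : ‖a‖ < 1) (hw : ‖w‖ = 1) : ‖diskAut a w‖ = 1 := by
  rw [diskAut, norm_div, div_eq_one_iff_eq (norm_pos_iff.2 (diskAut_denom_ne_zero ha hw.le)).ne']
  have := norm_sq_diskAut_denom_sub a w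
  rw [hw] at this
  exact (pow_left_inj₀ (norm_nonneg _) (norm_nonneg _) two_ne_zero).1 (by linarith)

theorem analyticAt_diskAut {a w : ℂ} (ha : ‖a‖ < 1) (hw : ‖w‖ ≤ 1) :
    AnalyticAt ℂ (diskAut a) w :=
  (by fun_prop : AnalyticAt ℂ (fun w => w + a) w).div (by fun_prop) (diskAut_denom_ne_zero ha hw)

theorem InnerProductSpace.HarmonicContOnCl.comp_diskAut {φ : ℂ → ℂ}
    (hφ : HarmonicContOnCl φ (ball 0 1)) {a : ℂ} (ha : ‖a‖ < 1) :
    HarmonicContOnCl (φ ∘ diskAut a) (ball 0 1) := by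
  have hM : AnalyticOnNhd ℂ (diskAut a) (ball 0 1) := fun w hw =>
    analyticAt_diskAut ha (mem_ball_zero_iff.1 hw).le
  have hmaps : MapsTo (diskAut a) (ball 0 1) (ball 0 1) := fun w hw =>
    mem_ball_zero_iff.2 (norm_diskAut_lt_one ha (mem_ball_zero_iff.1 hw))
  refine HarmonicContOnCl.mk_ball (harmonicOnNhd_of_re_im
    (harmonicOnNhd_comp_of_analyticOnNhd (f := fun w => (φ w).re) (hφ.1.comp_CLM reCLM) hM
      hmaps)
    (harmonicOnNhd_comp_of_analyticOnNhd (f := fun w => (φ w).im) (hφ.1.comp_CLM imCLM) hM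
      hmaps)) ?_
  refine hφ.continuousOn_ball.comp (fun w hw => (analyticAt_diskAut ha
    (mem_closedBall_zero_iff.1 hw)).continuousAt.continuousWithinAt) fun w hw => ?_
  rw [mem_closedBall_zero_iff] at hw ⊢
  rcases hw.lt_or_eq with h | h
  exacts [(norm_diskAut_lt_one ha h).le, (norm_diskAut_eq_one ha h).le]

theorem exists_pos_add_mul_mem_frontier {Ω : Set ℂ} (hΩo : IsOpen Ω)
    (hΩb : Bornology.IsBounded Ω) {p v : ℂ} (hp : p ∈ Ω) (hv : v ≠ 0) :
    ∃ t : ℝ, 0 < t ∧ p + t * v ∈ frontier Ω := by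
  obtain ⟨R, hR⟩ := hΩb.subset_closedBall p
  have hout : ∃ r : ℝ, 0 ≤ r ∧ p + r * v ∉ Ω := by
    refine ⟨(|R| + 1) / ‖v‖, by positivity, fun hmem => ?_⟩
    have h := hR hmem
    rw [mem_closedBall, dist_eq_norm, add_sub_cancel_left, norm_mul, norm_real, norm_div,
      norm_norm, div_mul_cancel₀ _ (norm_ne_zero_iff.2 hv), Real.norm_eq_abs] at h
    have := le_abs_self (|R| + 1)
    have := le_abs_self R
    linarith
  obtain ⟨r, hr0, hr⟩ := hout
  have hc : Continuous fun t : ℝ => p + t * v := by fun_prop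
  have hpre : IsPreconnected ((fun t : ℝ => p + t * v) '' Ici 0) :=
    isPreconnected_Ici.image _ hc.continuousOn
  by_contra! hno
  have hcl : ∀ t : ℝ, 0 ≤ t → p + t * v ∈ closure Ω → p + t * v ∈ Ω := by
    intro t ht hmem
    by_contra hnot
    rcases ht.eq_or_lt with rfl | ht
    · exact hnot (by simpa using hp)
    · exact hno t ht (hΩo.frontier_eq ▸ ⟨hmem, hnot⟩)
  obtain ⟨x, -, hx, hx'⟩ := hpre Ω (closure Ω)ᶜ hΩo isClosed_closure.isOpen_compl
    (by
      rintro _ ⟨t, ht, rfl⟩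
      by_cases h : p + t * v ∈ closure Ω
      exacts [Or.inl (hcl t ht h), Or.inr h])
    ⟨p, ⟨0, by simp, by simp⟩, hp⟩ ⟨_, ⟨r, hr0, rfl⟩, fun h => hr (hcl r hr0 h)⟩
  exact hx' (subset_closure hx)

theorem le_of_mem_frontier_of_ray {Ω : Set ℂ} (hΩo : IsOpen Ω) (hconv : Convex ℝ Ω)
    {p v : ℂ} (hp : p ∈ Ω) {t t' : ℝ} (ht : 0 < t) 
    (h : p + t * v ∈ frontier Ω) (h' : p + t' * v ∈ frontier Ω) : t' ≤ t := by
  by_contra! hlt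
  have hsub := hconv.openSegment_interior_closure_subset_interior
    (by rwa [hΩo.interior_eq]) (frontier_subset_closure h')
  rw [hΩo.frontier_eq] at h
  have ht' : 0 < t' := ht.trans hlt
  refine h.2 (hΩo.interior_eq ▸ hsub ⟨1 - t / t', t / t', ?_, by positivity, by ring, ?_⟩)
  · rw [sub_pos, div_lt_one ht']; exact hlt
  · have : (t' : ℂ) ≠ 0 := by exact_mod_cast ht'.ne'
    simp only [real_smul]
    push_cast
    field_simp
    ring

theorem continuousOn_poissonKernel_sphere {z : ℂ} (hz : ‖z‖ < 1) :
    ContinuousOn (poissonKernel 0 z) (sphere 0 1) := by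
  unfold poissonKernel
  refine ContinuousOn.div (by fun_prop) (by fun_prop) fun w hw => ?_
  have : w - z ≠ 0 := by
    intro h
    rw [sub_eq_zero.1 h, mem_sphere_zero_iff_norm] at hw
    exact hz.ne hw
  simpa using this

theorem mem_of_harmonicContOnCl {Ω : Set ℂ} (hΩo : IsOpen Ω) (hΩb : Bornology.IsBounded Ω)
    (hconv : Convex ℝ Ω) (hΩne : Ω.Nonempty) {φ : ℂ → ℂ} (hφ : HarmonicContOnCl φ (ball 0 1))
    (him : φ '' sphere 0 1 = frontier Ω) {z : ℂ} (hz : z ∈ ball (0 : ℂ) 1) : φ z ∈ Ω := by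
  by_contra hnot
  obtain ⟨l, hl⟩ := geometric_hahn_banach_open_point hconv hΩo hnot
  have hcl : ∀ y ∈ closure Ω, l y ≤ l (φ z) := fun y hy =>
    closure_minimal (fun a ha => (hl a ha).le) (isClosed_le l.continuous continuous_const) hy
  have hsph : ∀ w ∈ sphere (0 : ℂ) 1, φ w ∈ frontier Ω := fun w hw =>
    him ▸ mem_image_of_mem φ hw
  have hh : HarmonicContOnCl (fun w => l (φ z) - l (φ w)) (ball 0 1) :=
    harmonicContOnCl_const.fun_sub (hφ.comp_CLM l)
  have hav := hh.circleAverage_poissonKernel_smul hz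
  have hz1 : ‖z‖ < 1 := mem_ball_zero_iff.1 hz
  have hdist : ∀ w ∈ sphere (0 : ℂ) 1, w - z ≠ 0 := by
    intro w hw h
    rw [sub_eq_zero.1 h, mem_sphere_zero_iff_norm] at hw
    exact hz1.ne hw
  have hker : ∀ w ∈ sphere (0 : ℂ) 1, 0 < poissonKernel 0 z w := by
    intro w hw
    have h1 := mem_sphere_zero_iff_norm.1 hw
    rw [poissonKernel_def]
    simp only [sub_zero, h1]
    have := norm_pos_iff.2 (hdist w hw)
    exact div_pos (by nlinarith [norm_nonneg z]) (by positivity)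
  have hkc := continuousOn_poissonKernel_sphere hz1
  have hzero : ∀ w ∈ sphere (0 : ℂ) 1, l (φ w) = l (φ z) := by
    intro w hw
    by_contra hne
    have := circleAverage_pos_of_nonneg (hkc.smul (hh.continuousOn_ball.mono
      sphere_subset_closedBall)) (fun w hw => mul_nonneg (hker w hw).le
        (sub_nonneg.2 (hcl _ (frontier_subset_closure (hsph w hw))))) hw
        (mul_pos (hker w hw) (sub_pos.2
          ((hcl _ (frontier_subset_closure (hsph w hw))).lt_of_ne hne)))
    rw [hav] at this
    simp at this
  have hfr : ∀ y ∈ frontier Ω, l y = l (φ z) := by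
    rw [← him]
    rintro _ ⟨w, hw, rfl⟩
    exact hzero w hw
  obtain ⟨q, hq⟩ := hΩne
  have h1 := hfr _ (hsph 1 (by simp))
  have hne : q - φ 1 ≠ 0 := by
    intro h
    rw [← sub_eq_zero.1 h] at h1
    exact (hl q hq).ne h1
  obtain ⟨t, ht, hmem⟩ := exists_pos_add_mul_mem_frontier hΩo hΩb hq hne
  have h2 := hfr _ hmem
  rw [← real_smul, map_add, map_smul, map_sub, h1, smul_eq_mul] at h2
  nlinarith [hl q hq]

theorem exists_zero_of_injective_directions {g : ℂ → ℂ} (hg : ContinuousOn g (closedBall 0 1))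
    (hinj : ∀ w ∈ sphere (0 : ℂ) 1, ∀ w' ∈ sphere (0 : ℂ) 1, ∀ t : ℝ, 0 < t →
      g w = t * g w' → w = w') : ∃ z ∈ closedBall (0 : ℂ) 1, g z = 0 := by
  by_contra! hne
  have hmem : ∀ w : ℂ, w / (max 1 ‖w‖ : ℝ) ∈ closedBall (0 : ℂ) 1 := by
    intro w
    have h1 : 0 < max 1 ‖w‖ := by positivity
    rw [mem_closedBall_zero_iff, norm_div, norm_real, Real.norm_of_nonneg h1.le, div_le_one h1]
    exact le_max_right _ _
  have hmax : ∀ w : ℂ, ((max 1 ‖w‖ : ℝ) : ℂ) ≠ 0 := fun w => by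
    exact_mod_cast (by positivity : (0 : ℝ) < max 1 ‖w‖).ne'
  have hc : Continuous fun w : ℂ => w / (max 1 ‖w‖ : ℝ) :=
    continuous_id.div (by fun_prop) hmax
  have hsc : IsSimplyConnected (univ : Set ℂ) := by
    have := convex_univ (𝕜 := ℝ) (E := ℂ) |>.contractibleSpace univ_nonempty
    exact SimplyConnectedSpace.ofContractible _
  obtain ⟨L, hLc, hL⟩ := exists_continuousOn_eqOn_exp_comp (U := univ)
    (g := fun w => g (w / (max 1 ‖w‖ : ℝ)))
    hsc isOpen_univ (hg.comp_continuous hc hmem).continuousOn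
    (by rintro ⟨w, -, hw⟩; exact hne _ (hmem w) hw)
  have hexp : ∀ w ∈ sphere (0 : ℂ) 1, exp (L w) = g w := by
    intro w hw
    have := hL (mem_univ w)
    simpa [mem_sphere_zero_iff_norm.1 hw] using this
  rw [continuousOn_univ] at hLc
  let d : ℝ → ℝ := fun θ => (L (circleMap 0 1 θ)).im - (L (-circleMap 0 1 θ)).im
  have hd : Continuous d := by
    have := continuous_circleMap 0 1
    fun_prop
  have hpi : circleMap 0 1 Real.pi = -circleMap 0 1 0 := by simp [circleMap]
  have hdpi : d Real.pi = -d 0 := by simp [d, hpi]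
  obtain ⟨θ, hθ⟩ : ∃ θ, d θ = 0 := by
    rcases le_total (d 0) 0 with h | h
    · exact mem_range_of_exists_le_of_exists_ge hd ⟨0, h⟩ ⟨Real.pi, by linarith⟩
    · exact mem_range_of_exists_le_of_exists_ge hd ⟨Real.pi, by linarith⟩ ⟨0, h⟩
  set w := circleMap 0 1 θ with hw
  have hws : w ∈ sphere (0 : ℂ) 1 := circleMap_mem_sphere _ zero_le_one _
  have hws' : -w ∈ sphere (0 : ℂ) 1 := by simpa using hws
  have heq := hinj w hws (-w) hws' (Real.exp ((L w).re - (L (-w)).re)) (Real.exp_pos _) (by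
    rw [← hexp w hws, ← hexp _ hws', ofReal_exp, ← Complex.exp_add]
    congr 1
    apply Complex.ext
    · simp
    · simpa [d, sub_eq_zero] using hθ)
  have : w = 0 := by linear_combination heq / 2
  simp [this] at hws

theorem exists_sub_eq_pi {α : ℝ → ℝ} (hc : ContinuousOn α (Ioo 0 (2 * Real.pi)))
    (hm : StrictMonoOn α (Ioo 0 (2 * Real.pi))) {θ₁ θ₂ : ℝ} (h₁ : θ₁ ∈ Ioo 0 (2 * Real.pi))
    (h₂ : θ₂ ∈ Ioo 0 (2 * Real.pi)) (hα₁ : α θ₁ = -(Real.pi / 2)) (hα₂ : α θ₂ = Real.pi / 2) :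
    ∃ θ ∈ Ioo 0 Real.pi, α (2 * Real.pi - θ) - α θ = Real.pi := by
  have hpi := Real.pi_pos
  set τ := min θ₁ (2 * Real.pi - θ₂) with hτ
  have hτmem : τ ∈ Ioo 0 (2 * Real.pi) :=
    ⟨lt_min h₁.1 (by linarith [h₂.2]), (min_le_left _ _).trans_lt h₁.2⟩
  have hτmem' : 2 * Real.pi - τ ∈ Ioo 0 (2 * Real.pi) :=
    ⟨by linarith [hτmem.2], by linarith [hτmem.1]⟩
  have ha : α τ ≤ -(Real.pi / 2) :=
    hα₁ ▸ hm.monotoneOn hτmem h₁ (min_le_left _ _)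
  have hb : Real.pi / 2 ≤ α (2 * Real.pi - τ) :=
    hα₂ ▸ hm.monotoneOn h₂ hτmem' (by linarith [min_le_right θ₁ (2 * Real.pi - θ₂)])
  have hτpi : τ ≤ Real.pi := by
    by_contra! h
    have := hm hτmem' hτmem (by linarith)
    linarith
  have hsub : ∀ θ ∈ Icc τ Real.pi, θ ∈ Ioo 0 (2 * Real.pi) ∧
      2 * Real.pi - θ ∈ Ioo 0 (2 * Real.pi) :=
    fun θ hθ => by
      have := hτmem.1
      exact ⟨⟨by linarith [hθ.1], by linarith [hθ.2]⟩, by linarith [hθ.2], by linarith [hθ.1]⟩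
  have hβ : ContinuousOn (fun θ => α (2 * Real.pi - θ) - α θ) (Icc τ Real.pi) :=
    (hc.comp (by fun_prop) fun θ hθ => (hsub θ hθ).2).sub (hc.mono fun θ hθ => (hsub θ hθ).1)
  obtain ⟨θ, hθ, hval⟩ := intermediate_value_Icc' hτpi hβ
    (show Real.pi ∈ Icc _ _ from ⟨by simp [two_mul, hpi.le], by linarith⟩)
  refine ⟨θ, ⟨(hsub θ hθ).1.1, lt_of_le_of_ne hθ.2 ?_⟩, hval⟩
  rintro rfl
  simp [two_mul] at hval
  linarith

theorem exists_opposite_directions {G : ℝ → ℂ} (hG : Continuous G) (hG0 : ∀ θ, G θ ≠ 0)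
    (hinj : ∀ θ ∈ Ico 0 (2 * Real.pi), ∀ θ' ∈ Ico 0 (2 * Real.pi), ∀ t : ℝ, 0 < t →
      G θ = t * G θ' → θ = θ')
    (hsurj : ∀ v : ℂ, v ≠ 0 → ∃ θ ∈ Ico 0 (2 * Real.pi), ∃ t : ℝ, 0 < t ∧ G θ = t * v) :
    ∃ θ ∈ Ioo 0 Real.pi, ∃ t : ℝ, 0 < t ∧ G (2 * Real.pi - θ) = -(t * G θ) := by
  have hpi := Real.pi_pos
  have h0mem : (0 : ℝ) ∈ Ico 0 (2 * Real.pi) := ⟨le_rfl, Real.two_pi_pos⟩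
  let H : ℝ → ℂ := fun θ => -G θ / G 0
  have hH0 : ∀ θ, H θ ≠ 0 := fun θ => div_ne_zero (neg_ne_zero.2 (hG0 θ)) (hG0 0)
  have hGH : ∀ θ, G θ = -(H θ * G 0) := fun θ => by
    simp only [H]; rw [div_mul_cancel₀ _ (hG0 0), neg_neg]
  let α : ℝ → ℝ := fun θ => arg (H θ)
  have hslit : ∀ θ ∈ Ioo 0 (2 * Real.pi), H θ ∈ slitPlane := by
    intro θ hθ
    rw [mem_slitPlane_iff_arg]
    refine ⟨fun h => ?_, hH0 θ⟩
    have h1 : H θ = -(‖H θ‖ : ℂ) := by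
      conv_lhs => rw [← norm_mul_exp_arg_mul_I (H θ), h]
      simp
    have := hinj θ (Ioo_subset_Ico_self hθ) 0 h0mem ‖H θ‖ (norm_pos_iff.2 (hH0 θ)) (by
      rw [hGH θ]; nth_rewrite 1 [h1]; ring)
    exact hθ.1.ne' this
  have hαc : ContinuousOn α (Ioo 0 (2 * Real.pi)) := fun θ hθ =>
    ((continuousAt_arg (hslit θ hθ)).comp
      ((hG.neg.div_const _).continuousAt)).continuousWithinAt
  have hαinj : InjOn α (Ioo 0 (2 * Real.pi)) := by
    intro θ hθ θ' hθ' h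
    have h1 := (arg_eq_arg_iff (hH0 θ) (hH0 θ')).1 h
    refine hinj θ (Ioo_subset_Ico_self hθ) θ' (Ioo_subset_Ico_self hθ') (‖H θ‖ / ‖H θ'‖)
      (div_pos (norm_pos_iff.2 (hH0 θ)) (norm_pos_iff.2 (hH0 θ'))) ?_
    have h2 : (‖H θ'‖ : ℂ) ≠ 0 := by exact_mod_cast norm_ne_zero_iff.2 (hH0 θ')
    have h3 : (‖H θ‖ : ℂ) ≠ 0 := by exact_mod_cast norm_ne_zero_iff.2 (hH0 θ)
    have h4 : H θ = (‖H θ‖ / ‖H θ'‖ : ℂ) * H θ' := by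
      have h5 : (‖H θ‖ / ‖H θ'‖ : ℂ) * (‖H θ'‖ / ‖H θ‖) = 1 := by field_simp
      linear_combination (‖H θ‖ / ‖H θ'‖ : ℂ) * h1 - H θ * h5
    rw [hGH θ, hGH θ', ofReal_div]
    linear_combination (-G 0) * h4
  have hαsurj : ∀ v : ℂ, v ∈ slitPlane → ∃ θ ∈ Ioo 0 (2 * Real.pi), α θ = arg v := by
    intro v hv
    have hv0 : v ≠ 0 := slitPlane_ne_zero hv
    obtain ⟨θ, hθ, t, ht, hGt⟩ := hsurj (-(v * G 0)) (neg_ne_zero.2 (mul_ne_zero hv0 (hG0 0)))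
    have hHt : H θ = t * v := by
      simp only [H]
      rw [hGt]
      field_simp [hG0 0]
    have hα : α θ = arg v := by simp only [α]; rw [hHt, arg_real_mul _ ht]
    refine ⟨θ, ⟨lt_of_le_of_ne hθ.1 ?_, hθ.2⟩, hα⟩
    rintro rfl
    have : α 0 = Real.pi := by simp [α, H, neg_div, div_self (hG0 0)]
    exact (mem_slitPlane_iff_arg.1 hv).1 (hα ▸ this)
  obtain ⟨θ₁, h₁, hα₁⟩ := hαsurj (-I) (by simp [mem_slitPlane_iff])
  obtain ⟨θ₂, h₂, hα₂⟩ := hαsurj I (by simp [mem_slitPlane_iff])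
  rw [arg_neg_I] at hα₁
  rw [arg_I] at hα₂
  have key : ∃ θ ∈ Ioo 0 Real.pi,
      exp (α (2 * Real.pi - θ) * I) = -exp (α θ * I) := by
    rcases hαc.strictMonoOn_of_injOn_Ioo Real.two_pi_pos hαinj with hm | hm
    · obtain ⟨θ, hθ, h⟩ := exists_sub_eq_pi hαc hm h₁ h₂ (by linarith) hα₂
      refine ⟨θ, hθ, ?_⟩
      rw [← mul_neg_one, ← exp_pi_mul_I, ← Complex.exp_add]
      rw [sub_eq_iff_eq_add] at h
      rw [h]
      congr 1; push_cast; ring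
    · obtain ⟨θ, hθ, h⟩ := exists_sub_eq_pi (α := fun θ => -α θ) hαc.neg hm.neg h₂ h₁
        (by simp [hα₂]) (by simp [hα₁])
      refine ⟨θ, hθ, ?_⟩
      rw [eq_neg_iff_add_eq_zero, add_comm, ← eq_neg_iff_add_eq_zero, ← mul_neg_one,
        ← exp_pi_mul_I, ← Complex.exp_add]
      have h' : α θ = α (2 * Real.pi - θ) + Real.pi := by linarith
      rw [h']
      congr 1; push_cast; ring
  obtain ⟨θ, hθ, h⟩ := key
  have hn := hH0 θ
  refine ⟨θ, hθ, ‖H (2 * Real.pi - θ)‖ / ‖H θ‖,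
    div_pos (norm_pos_iff.2 (hH0 _)) (norm_pos_iff.2 hn), ?_⟩
  have h3 : (‖H θ‖ : ℂ) ≠ 0 := by exact_mod_cast norm_ne_zero_iff.2 hn
  have h4 : H (2 * Real.pi - θ) = -((‖H (2 * Real.pi - θ)‖ : ℂ) * exp (α θ * I)) := by
    rw [← mul_neg, ← h]; exact (norm_mul_exp_arg_mul_I _).symm
  have h5 : H θ = (‖H θ‖ : ℂ) * exp (α θ * I) := (norm_mul_exp_arg_mul_I _).symm
  have h6 : H (2 * Real.pi - θ) = -((‖H (2 * Real.pi - θ)‖ / ‖H θ‖ : ℂ) * H θ) := by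
    linear_combination h4 + (‖H (2 * Real.pi - θ)‖ / ‖H θ‖ : ℂ) * h5 + exp (α θ * I) *
      div_mul_cancel₀ (‖H (2 * Real.pi - θ)‖ : ℂ) h3
  rw [hGH θ, hGH (2 * Real.pi - θ), ofReal_div]
  linear_combination (-G 0) * h6

theorem constant_sign_of_ne_zero {F : ℝ → ℝ} (hF : Continuous F) {a b : ℝ}
    (h0 : ∀ θ ∈ Ioo a b, F θ ≠ 0) {c : ℝ} (hc : c ∈ Ioo a b) {θ : ℝ} (hθ : θ ∈ Ioo a b) :
    0 < F c * F θ := by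
  by_contra! h
  have hz : ∃ x ∈ Ioo a b, F x = 0 := by
    rcases mul_nonpos_iff.1 h with ⟨h1, h2⟩ | ⟨h1, h2⟩
    · exact isPreconnected_Ioo.intermediate_value hθ hc hF.continuousOn ⟨h2, h1⟩
    · exact isPreconnected_Ioo.intermediate_value hc hθ hF.continuousOn ⟨h1, h2⟩
  obtain ⟨x, hx, hx0⟩ := hz
  exact h0 x hx hx0

theorem poissonKernel_zero_mul_circleMap {u : ℂ} (hu : ‖u‖ = 1) (ρ θ : ℝ) :
    poissonKernel 0 (ρ * u) (u * circleMap 0 1 θ) =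
      (1 - ρ ^ 2) / (1 + ρ ^ 2 - 2 * ρ * Real.cos θ) := by
  have h1 : ‖u * circleMap 0 1 θ - ρ * u‖ ^ 2 = 1 + ρ ^ 2 - 2 * ρ * Real.cos θ := by
    rw [mul_comm (ρ : ℂ), ← mul_sub, norm_mul, hu, one_mul, ← normSq_eq_norm_sq, normSq_apply]
    simp [circleMap, exp_ofReal_mul_I_re, exp_ofReal_mul_I_im]
    nlinarith [Real.sin_sq_add_cos_sq θ]
  rw [poissonKernel_def]
  simp only [sub_zero]
  rw [h1]
  simp [hu]

/-- A harmonic map of the disk vanishing at the centre has no other zero, if its boundary values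
take every direction exactly once. -/
theorem false_of_two_zeros {g : ℂ → ℂ} (hg : HarmonicContOnCl g (ball 0 1))
    (h0 : ∀ w ∈ sphere (0 : ℂ) 1, g w ≠ 0)
    (hinj : ∀ w ∈ sphere (0 : ℂ) 1, ∀ w' ∈ sphere (0 : ℂ) 1, ∀ t : ℝ, 0 < t →
      g w = t * g w' → w = w')
    (hsurj : ∀ v : ℂ, v ≠ 0 → ∃ w ∈ sphere (0 : ℂ) 1, ∃ t : ℝ, 0 < t ∧ g w = t * v)
    (hg0 : g 0 = 0) {s : ℂ} (hs : ‖s‖ < 1) (hs0 : s ≠ 0) (hgs : g s = 0) : False := by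
  have hpi := Real.pi_pos
  obtain ⟨ρ, u, hρ, hu, hsu⟩ : ∃ (ρ : ℝ) (u : ℂ), 0 < ρ ∧ ‖u‖ = 1 ∧ s = ρ * u := by
    have hn : (‖s‖ : ℂ) ≠ 0 := by exact_mod_cast norm_ne_zero_iff.2 hs0
    refine ⟨‖s‖, s / ‖s‖, norm_pos_iff.2 hs0, ?_, by field_simp⟩
    rw [norm_div, norm_real, norm_norm, div_self (norm_ne_zero_iff.2 hs0)]
  have hρ1 : ρ < 1 := by
    rwa [hsu, norm_mul, hu, mul_one, norm_real, Real.norm_of_nonneg hρ.le] at hs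
  have hu0 : u ≠ 0 := norm_ne_zero_iff.1 (by rw [hu]; exact one_ne_zero)
  let e : ℝ → ℂ := fun θ => u * circleMap 0 1 θ
  have hec : Continuous e := continuous_const.mul (continuous_circleMap 0 1)
  have hesph : ∀ θ, e θ ∈ sphere (0 : ℂ) 1 := by
    intro θ
    simp [e, hu]
  have hper : ∀ θ, e (θ + 2 * Real.pi) = e θ := fun θ => by
    simp only [e, periodic_circleMap 0 1 θ]
  have heinj : ∀ θ ∈ Ico 0 (2 * Real.pi), ∀ θ' ∈ Ico 0 (2 * Real.pi), e θ = e θ' → θ = θ' := by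
    intro θ hθ θ' hθ' h
    have h1 := mul_left_cancel₀ hu0 h
    refine injOn_circleMap_of_abs_sub_le' (c := 0) one_ne_zero (by simp) hθ hθ' h1
  have hesurj : ∀ w ∈ sphere (0 : ℂ) 1, ∃ θ ∈ Ico 0 (2 * Real.pi), e θ = w := by
    intro w hw
    have hw1 := mem_sphere_zero_iff_norm.1 hw
    obtain ⟨θ, hθ, h⟩ : w / u ∈ circleMap 0 1 '' Ioc 0 (2 * Real.pi) := by
      rw [image_circleMap_Ioc]
      simp [hw1, hu]
    have h' : e θ = w := by simp only [e, h]; field_simp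
    rcases hθ.2.lt_or_eq with hlt | heq
    · exact ⟨θ, ⟨hθ.1.le, hlt⟩, h'⟩
    · refine ⟨0, ⟨le_rfl, Real.two_pi_pos⟩, ?_⟩
      rw [← h', heq, ← hper 0, zero_add]
  have hgc : Continuous fun θ => g (e θ) :=
    hg.continuousOn_ball.comp_continuous hec fun θ => sphere_subset_closedBall (hesph θ)
  obtain ⟨θ₀, hθ₀, r, hr, hopp⟩ := exists_opposite_directions hgc (fun θ => h0 _ (hesph θ))
    (fun θ hθ θ' hθ' t ht h => heinj θ hθ θ' hθ' (hinj _ (hesph θ) _ (hesph θ') t ht h))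
    (fun v hv => by
      obtain ⟨w, hw, t, ht, h⟩ := hsurj v hv
      obtain ⟨θ, hθ, rfl⟩ := hesurj w hw
      exact ⟨θ, hθ, t, ht, h⟩)
  have hθ₀' : θ₀ ∈ Ico 0 (2 * Real.pi) := ⟨hθ₀.1.le, by linarith [hθ₀.2]⟩
  have hθ₁' : 2 * Real.pi - θ₀ ∈ Ico 0 (2 * Real.pi) := ⟨by linarith [hθ₀.2], by linarith [hθ₀.1]⟩
  set q := g (e θ₀) with hq
  have hq0 : q ≠ 0 := h0 _ (hesph θ₀)
  let f : ℂ → ℝ := fun w => (g w / q).im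
  have hzero : ∀ θ ∈ Ico 0 (2 * Real.pi), f (e θ) = 0 → θ = θ₀ ∨ θ = 2 * Real.pi - θ₀ := by
    intro θ hθ h
    have h1 : g (e θ) = ((g (e θ) / q).re : ℂ) * q := by
      have : ((g (e θ) / q).re : ℂ) = g (e θ) / q := Complex.ext (by simp) (by simpa using h.symm)
      rw [this, div_mul_cancel₀ _ hq0]
    set x := (g (e θ) / q).re
    have hx : x ≠ 0 := by
      intro hx
      exact h0 _ (hesph θ) (by rw [h1, hx]; simp)
    rcases hx.lt_or_gt with hx | hx
    · right
      refine heinj _ hθ _ hθ₁' (hinj _ (hesph _) _ (hesph _) (-x / r)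
        (div_pos (neg_pos.2 hx) hr) ?_)
      have hr' : (r : ℂ) ≠ 0 := by exact_mod_cast hr.ne'
      rw [hopp, h1]
      push_cast
      field_simp
    · exact Or.inl (heinj _ hθ _ hθ₀' (hinj _ (hesph _) _ (hesph _) x hx h1))
  have hF : Continuous fun θ => f (e θ) := continuous_im.comp (hgc.div_const q)
  have hne₁ : ∀ θ ∈ Ioo (-θ₀) θ₀, f (e θ) ≠ 0 := by
    intro θ hθ h
    rcases le_or_gt 0 θ with h1 | h1
    · rcases hzero θ ⟨h1, by linarith [hθ.2, hθ₀.2]⟩ h with h2 | h2 <;>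
        linarith [hθ.2, hθ₀.2]
    · rw [← hper] at h
      rcases hzero _ ⟨by linarith [hθ.1, hθ₀.2], by linarith⟩ h with h2 | h2 <;>
        linarith [hθ.1, hθ₀.2]
  have hne₂ : ∀ θ ∈ Ioo θ₀ (2 * Real.pi - θ₀), f (e θ) ≠ 0 := by
    intro θ hθ h
    rcases hzero θ ⟨by linarith [hθ.1, hθ₀.1], by linarith [hθ.2, hθ₀.1]⟩ h with h2 | h2 <;>
      linarith [hθ.1, hθ.2]
  have hm₁ : (0 : ℝ) ∈ Ioo (-θ₀) θ₀ := ⟨by linarith [hθ₀.1], hθ₀.1⟩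
  have hm₂ : Real.pi ∈ Ioo θ₀ (2 * Real.pi - θ₀) := ⟨hθ₀.2, by linarith [hθ₀.2]⟩
  let f' : ℂ → ℝ := fun w => f (e 0) * f w
  have hpos₁ : ∀ θ ∈ Ioo (-θ₀) θ₀, 0 < f' (e θ) := fun θ hθ =>
    constant_sign_of_ne_zero hF hne₁ hm₁ hθ
  have hend₀ : f' (e θ₀) = 0 := by simp [f', f, ← hq, div_self hq0]
  have hend₁ : f' (e (2 * Real.pi - θ₀)) = 0 := by
    simp only [f', f]
    rw [hopp, neg_div, mul_div_assoc, div_self hq0]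
    simp
  have hcover : ∀ w ∈ sphere (0 : ℂ) 1, ∃ θ, e θ = w ∧ (θ ∈ Ioo (-θ₀) θ₀ ∨
      θ ∈ Ioo θ₀ (2 * Real.pi - θ₀) ∨ θ = θ₀ ∨ θ = 2 * Real.pi - θ₀) := by
    intro w hw
    obtain ⟨θ, hθ, rfl⟩ := hesurj w hw
    rcases lt_trichotomy θ θ₀ with h | h | h
    · exact ⟨θ, rfl, Or.inl ⟨by linarith [hθ.1, hθ₀.1], h⟩⟩
    · exact ⟨θ, rfl, Or.inr (Or.inr (Or.inl h))⟩
    rcases lt_trichotomy θ (2 * Real.pi - θ₀) with h' | h' | h'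
    · exact ⟨θ, rfl, Or.inr (Or.inl ⟨h, h'⟩)⟩
    · exact ⟨θ, rfl, Or.inr (Or.inr (Or.inr h'))⟩
    · refine ⟨θ - 2 * Real.pi, ?_, Or.inl ⟨by linarith, by linarith [hθ.2, hθ₀.1]⟩⟩
      rw [← hper, sub_add_cancel]
  have hf' : HarmonicContOnCl f' (ball 0 1) := by
    let l : ℂ →L[ℝ] ℝ := f (e 0) • imCLM.comp (ContinuousLinearMap.mul ℝ ℂ q⁻¹)
    convert hg.comp_CLM l using 1
    ext w
    simp only [f', f, l, Function.comp_apply, _root_.smul_apply,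
      ContinuousLinearMap.comp_apply, ContinuousLinearMap.mul_apply', imCLM_apply, smul_eq_mul,
      div_eq_inv_mul]
  have hf'c : ContinuousOn f' (sphere 0 1) :=
    hf'.continuousOn_ball.mono sphere_subset_closedBall
  have hav : Real.circleAverage f' 0 1 = 0 := by
    rw [InnerProductSpace.HarmonicContOnCl.circleAverage_eq (by rwa [abs_one])]
    simp [f', f, hg0]
  have havs : Real.circleAverage (poissonKernel 0 s • f') 0 1 = 0 := by
    rw [hf'.circleAverage_poissonKernel_smul (mem_ball_zero_iff.2 hs)]
    simp [f', f, hgs]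
  rcases (mul_ne_zero (hne₁ 0 hm₁) (hne₂ Real.pi hm₂)).lt_or_gt with hsgn | hsgn
  · have hneg₂ : ∀ θ ∈ Ioo θ₀ (2 * Real.pi - θ₀), f' (e θ) < 0 := by
      intro θ hθ
      have h1 := constant_sign_of_ne_zero hF hne₂ hm₂ hθ
      by_contra! h2
      simp only [f'] at h2
      nlinarith [mul_pos_of_neg_of_neg hsgn (neg_neg_of_pos h1), sq_nonneg (f (e Real.pi)),
        mul_nonneg h2 (sq_nonneg (f (e Real.pi)))]
    set C : ℝ := (1 - ρ ^ 2) / (1 + ρ ^ 2 - 2 * ρ * Real.cos θ₀) with hC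
    have hden : ∀ θ : ℝ, 0 < 1 + ρ ^ 2 - 2 * ρ * Real.cos θ := by
      intro θ
      nlinarith [Real.cos_le_one θ, mul_nonneg hρ.le (sub_nonneg.2 (Real.cos_le_one θ)),
        sq_pos_of_pos (sub_pos.2 hρ1)]
    have hnum : 0 < 1 - ρ ^ 2 := by nlinarith
    have hker : ∀ θ, poissonKernel 0 s (e θ) =
        (1 - ρ ^ 2) / (1 + ρ ^ 2 - 2 * ρ * Real.cos θ) := fun θ => by
      rw [hsu, poissonKernel_zero_mul_circleMap hu]
    have hk₁ : ∀ θ ∈ Ioo (-θ₀) θ₀, C < poissonKernel 0 s (e θ) := by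
      intro θ hθ
      have hcos : Real.cos θ₀ < Real.cos θ := by
        rw [← Real.cos_abs θ]
        exact Real.cos_lt_cos_of_nonneg_of_le_pi (abs_nonneg _) hθ₀.2.le (abs_lt.2 hθ)
      rw [hker, hC]
      exact div_lt_div_of_pos_left hnum (hden θ) (by nlinarith)
    have hk₂ : ∀ θ ∈ Ioo θ₀ (2 * Real.pi - θ₀), poissonKernel 0 s (e θ) < C := by
      intro θ hθ
      have hcos : Real.cos θ < Real.cos θ₀ := by
        rcases le_total θ Real.pi with h | h
        · exact Real.cos_lt_cos_of_nonneg_of_le_pi hθ₀.1.le h hθ.1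
        · rw [← Real.cos_two_pi_sub θ]
          exact Real.cos_lt_cos_of_nonneg_of_le_pi hθ₀.1.le (by linarith) (by linarith [hθ.2])
      rw [hker, hC]
      exact div_lt_div_of_pos_left hnum (hden θ₀) (by nlinarith)
    have hkc := (continuousOn_poissonKernel_sphere hs).smul hf'c
    have hval : ∀ w, (poissonKernel 0 s • f' - C • f') w = (poissonKernel 0 s w - C) * f' w :=
      fun w => (sub_mul _ _ _).symm
    have hpos := circleAverage_pos_of_nonneg
      (h := poissonKernel 0 s • f' - C • f') (hkc.sub (hf'c.const_smul C)) (fun w hw => ?_)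
      (hesph 0) ?_
    · rw [Real.circleAverage_sub (hkc.circleIntegrable zero_le_one)
        ((hf'c.const_smul C).circleIntegrable zero_le_one), Real.circleAverage_smul, havs, hav]
        at hpos
      simp at hpos
    · obtain ⟨θ, rfl, h | h | rfl | rfl⟩ := hcover w hw
      · rw [hval]
        exact mul_nonneg (sub_nonneg.2 (hk₁ θ h).le) (hpos₁ θ h).le
      · rw [hval]
        exact mul_nonneg_of_nonpos_of_nonpos (sub_nonpos.2 (hk₂ θ h).le) (hneg₂ θ h).le
      · simp [hend₀]
      · simp [hend₁]
    · rw [hval]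
      exact mul_pos (sub_pos.2 (hk₁ 0 hm₁)) (hpos₁ 0 hm₁)
  · have hpos₂ : ∀ θ ∈ Ioo θ₀ (2 * Real.pi - θ₀), 0 < f' (e θ) := by
      intro θ hθ
      have h1 := constant_sign_of_ne_zero hF hne₂ hm₂ hθ
      by_contra! h2
      simp only [f'] at h2
      nlinarith [mul_pos hsgn h1, sq_nonneg (f (e Real.pi)),
        mul_nonneg (neg_nonneg.2 h2) (sq_nonneg (f (e Real.pi)))]
    have hpos := circleAverage_pos_of_nonneg hf'c (fun w hw => ?_) (hesph 0) (hpos₁ 0 hm₁)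
    · rw [hav] at hpos
      exact hpos.false
    · obtain ⟨θ, rfl, h | h | rfl | rfl⟩ := hcover w hw
      exacts [(hpos₁ θ h).le, (hpos₂ θ h).le, hend₀.ge, hend₁.ge]

theorem bijOn_closedBall_closure_of_harmonicContOnCl {Ω : Set ℂ} (hΩo : IsOpen Ω)
    (hΩb : Bornology.IsBounded Ω) (hconv : Convex ℝ Ω) (hΩne : Ω.Nonempty) {φ : ℂ → ℂ}
    (hφ : HarmonicContOnCl φ (ball 0 1)) (hinj : InjOn φ (sphere 0 1))
    (him : φ '' sphere 0 1 = frontier Ω) : BijOn φ (closedBall 0 1) (closure Ω) := by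
  have hball : ∀ z ∈ ball (0 : ℂ) 1, φ z ∈ Ω := fun z hz =>
    mem_of_harmonicContOnCl hΩo hΩb hconv hΩne hφ him hz
  have hsph : ∀ w ∈ sphere (0 : ℂ) 1, φ w ∈ frontier Ω := fun w hw =>
    him ▸ mem_image_of_mem φ hw
  have hdisj : ∀ y ∈ frontier Ω, y ∉ Ω := fun y hy => (hΩo.frontier_eq ▸ hy).2
  have hsub0 : ∀ p ∈ Ω, ∀ w ∈ sphere (0 : ℂ) 1, φ w - p ≠ 0 := fun p hp w hw h =>
    hdisj _ (hsph w hw) (sub_eq_zero.1 h ▸ hp)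
  have hsubinj : ∀ p ∈ Ω, ∀ w ∈ sphere (0 : ℂ) 1, ∀ w' ∈ sphere (0 : ℂ) 1, ∀ t : ℝ, 0 < t →
      φ w - p = t * (φ w' - p) → w = w' := by
    intro p hp w hw w' hw' t ht h
    have h1 : p + (1 : ℝ) * (φ w' - p) ∈ frontier Ω := by simpa using hsph w' hw'
    have h2 : p + t * (φ w' - p) ∈ frontier Ω := by rw [← h]; simpa using hsph w hw
    have ht1 : t = 1 := le_antisymm (le_of_mem_frontier_of_ray hΩo hconv hp one_pos h1 h2)
      (le_of_mem_frontier_of_ray hΩo hconv hp ht h2 h1)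
    rw [ht1] at h
    exact hinj hw hw' (by simpa using h)
  have hsubsurj : ∀ p ∈ Ω, ∀ v : ℂ, v ≠ 0 → ∃ w ∈ sphere (0 : ℂ) 1, ∃ t : ℝ, 0 < t ∧
      φ w - p = t * v := by
    intro p hp v hv
    obtain ⟨t, ht, hmem⟩ := exists_pos_add_mul_mem_frontier hΩo hΩb hp hv
    rw [← him] at hmem
    obtain ⟨w, hw, h⟩ := hmem
    exact ⟨w, hw, t, ht, by rw [h]; ring⟩
  have hballinj : InjOn φ (ball 0 1) := by
    intro z₁ hz₁ z₂ hz₂ h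
    by_contra hne
    have ha : ‖z₁‖ < 1 := mem_ball_zero_iff.1 hz₁
    have hb : ‖z₂‖ < 1 := mem_ball_zero_iff.1 hz₂
    have ha' : ‖-z₁‖ < 1 := by rwa [norm_neg]
    have hp := hball z₁ hz₁
    have hinv : ∀ w, ‖w‖ ≤ 1 → diskAut z₁ (diskAut (-z₁) w) = w := fun w hw => by
      simpa using diskAut_neg_diskAut ha' hw
    have haut : ∀ w ∈ sphere (0 : ℂ) 1, diskAut z₁ w ∈ sphere (0 : ℂ) 1 := fun w hw =>
      mem_sphere_zero_iff_norm.2 (norm_diskAut_eq_one ha (mem_sphere_zero_iff_norm.1 hw))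
    have haut0 : diskAut z₁ 0 = z₁ := by simp [diskAut]
    refine false_of_two_zeros (g := fun w => φ (diskAut z₁ w) - φ z₁)
      (s := diskAut (-z₁) z₂) ((hφ.comp_diskAut ha).fun_sub harmonicContOnCl_const)
      (fun w hw => hsub0 _ hp _ (haut w hw)) ?_ ?_ ?_ (norm_diskAut_lt_one ha' hb) ?_ ?_
    · intro w hw w' hw' t ht ht'
      have h1 := hsubinj _ hp _ (haut w hw) _ (haut w' hw') t ht ht'
      rw [← diskAut_neg_diskAut ha (mem_sphere_zero_iff_norm.1 hw).le, h1,
        diskAut_neg_diskAut ha (mem_sphere_zero_iff_norm.1 hw').le]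
    · intro v hv
      obtain ⟨w, hw, t, ht, hwt⟩ := hsubsurj _ hp v hv
      have hw1 := mem_sphere_zero_iff_norm.1 hw
      refine ⟨diskAut (-z₁) w, mem_sphere_zero_iff_norm.2 (norm_diskAut_eq_one ha' hw1), t, ht, ?_⟩
      simp only [hinv w hw1.le, hwt]
    · simp [haut0]
    · intro h0
      exact hne (by rw [← hinv z₂ hb.le, h0, haut0])
    · simp [hinv z₂ hb.le, h]
  have hcases : ∀ z ∈ closedBall (0 : ℂ) 1, z ∈ ball (0 : ℂ) 1 ∨ z ∈ sphere (0 : ℂ) 1 :=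
    fun z hz => by rwa [← mem_union, ball_union_sphere]
  refine ⟨fun z hz => ?_, fun z hz w hw h => ?_, fun y hy => ?_⟩
  · rcases hcases z hz with h | h
    exacts [subset_closure (hball z h), frontier_subset_closure (hsph z h)]
  · rcases hcases z hz with h1 | h1 <;> rcases hcases w hw with h2 | h2
    · exact hballinj h1 h2 h
    · exact absurd (h ▸ hball z h1) (hdisj _ (hsph w h2))
    · exact absurd (h ▸ hball w h2) (hdisj _ (hsph z h1))
    · exact hinj h1 h2 h
  · by_cases hyΩ : y ∈ Ω
    · obtain ⟨z, hz, h⟩ := exists_zero_of_injective_directions (g := fun z => φ z - y)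
        (hφ.continuousOn_ball.sub continuousOn_const) (hsubinj y hyΩ)
      exact ⟨z, hz, sub_eq_zero.1 h⟩
    · have hfr : y ∈ frontier Ω := by rw [hΩo.frontier_eq]; exact ⟨hy, hyΩ⟩
      rw [← him] at hfr
      exact image_mono sphere_subset_closedBall hfr

end

/-- Radó–Kneser–Choquet, Theorem 1 of the paper. Let `γ` be a
homeomorphism of the unit circle onto a simple closed curve `Γ = ∂Ω` enclosing the bounded
open set `Ω` (encoded by a continuous `2π`-periodic parametrization, injective on a period,
with range `frontier Ω`), and let `φ` be the harmonic extension of `γ` (continuous on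
`cl 𝔹`, `C²` and componentwise harmonic in `𝔹`, equal to `γ` on `∂𝔹`). If `Ω` is convex,
then `φ` is a homeomorphism of `cl 𝔹` onto `cl Ω` (equivalently, since `φ` is continuous
on the compact set `cl 𝔹`, a bijection of `cl 𝔹` onto `cl Ω`). -/
theorem rado_kneser_choquet
    (Ω : Set ℂ) (γ : ℝ → ℂ) (φ : ℂ → ℂ)
    (hΩo : IsOpen Ω) (hΩb : Bornology.IsBounded Ω)
    (hγc : Continuous γ) (hγper : ∀ θ, γ (θ + 2 * Real.pi) = γ θ)
    (hγinj : Set.InjOn γ (Set.Ico 0 (2 * Real.pi)))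
    (hγrange : Set.range γ = frontier Ω)
    (hφcont : ContinuousOn φ (closedBall (0 : ℂ) 1))
    (hφC2 : ContDiffOn ℝ 2 φ (ball (0 : ℂ) 1))
    (hφharm : HarmonicOn2 φ (ball (0 : ℂ) 1))
    (hφbd : ∀ θ : ℝ, φ (cpt θ) = γ θ)
    (hconv : Convex ℝ Ω) :
    Set.BijOn φ (closedBall (0 : ℂ) 1) (closure Ω) := by
  have hcircle : ∀ θ, cpt θ = circleMap 0 1 θ := fun θ => by simp [cpt, circleMap]
  have hsph : ∀ θ, cpt θ ∈ sphere (0 : ℂ) 1 := fun θ => by simp [hcircle]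
  have hsurj : ∀ w ∈ sphere (0 : ℂ) 1, ∃ θ ∈ Ico 0 (2 * Real.pi), cpt θ = w := by
    intro w hw
    obtain ⟨θ, hθ, h⟩ : w ∈ circleMap 0 1 '' Ioc 0 (2 * Real.pi) := by
      rw [image_circleMap_Ioc]; simpa using hw
    rcases hθ.2.lt_or_eq with hlt | heq
    · exact ⟨θ, ⟨hθ.1.le, hlt⟩, by rw [hcircle, h]⟩
    · refine ⟨0, ⟨le_rfl, Real.two_pi_pos⟩, ?_⟩
      rw [hcircle, ← h, heq, ← periodic_circleMap 0 1 0, zero_add]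
  have hinj : InjOn φ (sphere 0 1) := by
    intro w hw w' hw' h
    obtain ⟨θ, hθ, rfl⟩ := hsurj w hw
    obtain ⟨θ', hθ', rfl⟩ := hsurj w' hw'
    rw [hφbd, hφbd] at h
    rw [hγinj hθ hθ' h]
  have him : φ '' sphere 0 1 = frontier Ω := by
    rw [← hγrange]
    ext y
    constructor
    · rintro ⟨w, hw, rfl⟩
      obtain ⟨θ, -, rfl⟩ := hsurj w hw
      exact ⟨θ, (hφbd θ).symm⟩
    · rintro ⟨θ, rfl⟩
      exact ⟨cpt θ, hsph θ, hφbd θ⟩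
  have hΩne : Ω.Nonempty := by
    rw [nonempty_iff_ne_empty]
    rintro rfl
    have h := hγrange ▸ mem_range_self (f := γ) 0
    simp at h
  exact bijOn_closedBall_closure_of_harmonicContOnCl hΩo hΩb hconv hΩne
    (.mk_ball (hφharm.harmonicOnNhd isOpen_ball hφC2) hφcont) hinj him
end
end
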